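/- Let q ≥ 2 be an integer and β > q, and let c(β,q) = (2·log(1/F′(a)))⁻¹. There exists ε₀ > 0 such that the following holds for every constant ε ∈ (0, ε₀] and every constant γ > 0: if the starting configuration X₀ satisfies ‖α(X₀) − m‖_∞ ≤ ε, and T = ⌈c(β,q)·log n + γ⌉, then for any constant δ ∈ (0,1) there exists a constant C = C(γ, δ) > 0 such that for all sufficiently large n, with probability at least δ, ‖α(X_T) − m‖_∞ ≤ C/√n. -/

import Mathlib

open scoped Classical
open Finset

/-- Spin configurations on `n` vertices with `q` spins. -/
abbrev Conf (n q : ℕ) := Fin n → Fin q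

/-- Number of vertices assigned spin `j`. -/
def cntN {n q : ℕ} (X : Conf n q) (j : Fin q) : ℕ :=
  (Finset.univ.filter (fun v => X v = j)).card

/-- Number of monochromatic pairs `{u,v}` (`u < v`, same spin). -/
def numMono {n q : ℕ} (σ : Conf n q) : ℕ :=
  (Finset.univ.filter (fun p : Fin n × Fin n => p.1 < p.2 ∧ σ p.1 = σ p.2)).card

/-- The mean-field `q`-state Potts measure: probability of `σ`. -/
noncomputable def pottsProb (n q : ℕ) (β : ℝ) (σ : Conf n q) : ℝ :=
  Real.exp (β / n * numMono σ) / ∑ τ : Conf n q, Real.exp (β / n * numMono τ)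

/-- The set of monochromatic pairs of a configuration. -/
def monoPairs {n q : ℕ} (σ : Conf n q) : Finset (Fin n × Fin n) :=
  Finset.univ.filter (fun p : Fin n × Fin n => p.1 < p.2 ∧ σ p.1 = σ p.2)

/-- The graph on `Fin n` whose edges are the pairs in `E`. -/
def graphOf {n : ℕ} (E : Finset (Fin n × Fin n)) : SimpleGraph (Fin n) :=
  SimpleGraph.fromRel (fun u v => (u, v) ∈ E)

/-- Number of connected components of the graph `(V, E)`. -/
noncomputable def numComps {n : ℕ} (E : Finset (Fin n × Fin n)) : ℕ :=
  Nat.card (graphOf E).ConnectedComponent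

/-- One-step transition probability of the Swendsen–Wang dynamics:
percolate on monochromatic pairs with probability `p = 1 - exp (-β/n)`,
then color each connected component uniformly at random. -/
noncomputable def swStep (n q : ℕ) (β : ℝ) (σ τ : Conf n q) : ℝ :=
  ∑ E ∈ (monoPairs σ).powerset,
    ((1 - Real.exp (-(β / n))) ^ E.card *
        Real.exp (-(β / n)) ^ ((monoPairs σ).card - E.card)) *
      (if ∀ u v : Fin n, (graphOf E).Reachable u v → τ u = τ v then
        ((q : ℝ))⁻¹ ^ numComps E else 0)

/-- `t`-step transition probability of the Swendsen–Wang dynamics. -/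
noncomputable def swProb (n q : ℕ) (β : ℝ) : ℕ → Conf n q → Conf n q → ℝ
  | 0, σ, τ => if σ = τ then 1 else 0
  | t + 1, σ, τ => ∑ η : Conf n q, swStep n q β σ η * swProb n q β t η τ

/-- Probability of observing the trajectory `ω 0, ω 1, …, ω (ℓ-1)` at times
`1, …, ℓ` for the SW dynamics started at `X₀`. -/
noncomputable def pathProb (n q : ℕ) (β : ℝ) (X₀ : Conf n q) (ℓ : ℕ)
    (ω : Fin ℓ → Conf n q) : ℝ :=
  ∏ i : Fin ℓ, swStep n q β
    (if _h : 0 < (i : ℕ) then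
        ω ⟨(i : ℕ) - 1, lt_of_le_of_lt (Nat.sub_le _ _) i.isLt⟩
      else X₀) (ω i)

/-- Total variation distance between two probability vectors on configurations. -/
noncomputable def tvDist {n q : ℕ} (f g : Conf n q → ℝ) : ℝ :=
  (∑ τ : Conf n q, |f τ - g τ|) / 2

/-- Mixing time `τ_mix(ε)` of the SW dynamics. -/
noncomputable def mixingTime (n q : ℕ) (β ε : ℝ) : ℕ :=
  sInf {t : ℕ | ∀ σ : Conf n q, tvDist (swProb n q β t σ) (pottsProb n q β) ≤ ε}

/-- `theta lam` is the unique root in `(0,1)` of `exp (-lam * x) = 1 - x`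
for `lam > 1`, and `0` for `lam ≤ 1`. -/
noncomputable def theta (lam : ℝ) : ℝ :=
  if lam ≤ 1 then 0
  else sSup {x : ℝ | x ∈ Set.Ioo (0 : ℝ) 1 ∧ Real.exp (-lam * x) = 1 - x}

/-- The drift function `F`. -/
noncomputable def F (q : ℕ) (β : ℝ) (x : ℝ) : ℝ :=
  1 / q + (1 - 1 / q) * theta (β * x) * x

/-- The unique fixed point of `F` in `(1/q, 1]` (for `β > q`). -/
noncomputable def aFix (q : ℕ) (β : ℝ) : ℝ :=
  sSup {x : ℝ | x ∈ Set.Ioc (1 / (q : ℝ)) 1 ∧ F q β x = x}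

/-- The cutoff constant `c(β,q) = (2 log (1 / F'(a)))⁻¹`. -/
noncomputable def cConst (q : ℕ) (β : ℝ) : ℝ :=
  (2 * Real.log (1 / deriv (F q β) (aFix q β)))⁻¹

/-- Fraction of vertices assigned spin `j`. -/
noncomputable def cntFrac {n q : ℕ} (X : Conf n q) : Fin q → ℝ :=
  fun j => (cntN X j : ℝ) / n

/-- The proportions vector `α(X)`: fractions of vertices of each spin,
sorted in nonincreasing order. -/
noncomputable def alphaVec {n q : ℕ} (X : Conf n q) : Fin q → ℝ :=
  fun i => cntFrac X (Tuple.sort (cntFrac X) i.rev)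

/-- `ℓ∞` distance between two vectors indexed by `Fin q`. -/
noncomputable def linf {q : ℕ} (f g : Fin q → ℝ) : ℝ :=
  ⨆ i : Fin q, |f i - g i|

/-- The vector `κ(b) = (b, (1-b)/(q-1), …, (1-b)/(q-1))`. -/
noncomputable def kappaVec (q : ℕ) (b : ℝ) : Fin q → ℝ :=
  fun i => if (i : ℕ) = 0 then b else (1 - b) / ((q : ℝ) - 1)

/-- The majority vector `m = (a, (1-a)/(q-1), …, (1-a)/(q-1))`. -/
noncomputable def mVec (q : ℕ) (β : ℝ) : Fin q → ℝ :=
  kappaVec q (aFix q β)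

/-- Index of the most common spin of `X` (least such index on ties). -/
noncomputable def domIdx {n q : ℕ} (X : Conf n q) : ℕ :=
  sInf {j : ℕ | ∃ hj : j < q, ∀ j' : Fin q, cntN X j' ≤ cntN X ⟨j, hj⟩}

/-- `α₁(X)`: fraction of vertices carrying the most common spin of `X`. -/
noncomputable def alpha1 {n q : ℕ} (X : Conf n q) : ℝ :=
  ((Finset.univ.filter (fun v : Fin n => (X v : ℕ) = domIdx X)).card : ℝ) / n

/-- `α_{1,k}(X)`: fraction of vertices of `Vk` carrying the most common spin of `X`. -/
noncomputable def alpha1In {n q : ℕ} (X : Conf n q) (Vk : Finset (Fin n)) : ℝ :=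
  ((Vk.filter (fun v => (X v : ℕ) = domIdx X)).card : ℝ) / Vk.card

/-- `P` is a partition of the vertex set into `q` classes. -/
def IsPartition {n q : ℕ} (P : Fin q → Finset (Fin n)) : Prop :=
  (∀ i j, i ≠ j → Disjoint (P i) (P j)) ∧ ∀ v : Fin n, ∃ i, v ∈ P i

/-- A `λ`-partition: a partition with all classes of size at least `λ n`. -/
def IsLamPartition {n q : ℕ} (lam : ℝ) (P : Fin q → Finset (Fin n)) : Prop :=
  IsPartition P ∧ ∀ i, lam * n ≤ ((P i).card : ℝ)

/-- Projection: `projCnt P X i j` is the number of vertices of `P i`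
assigned spin `j` in `X`. -/
def projCnt {n q : ℕ} (P : Fin q → Finset (Fin n)) (X : Conf n q) :
    Fin q → Fin q → ℕ :=
  fun i j => ((P i).filter (fun v => X v = j)).card

/-- All potential edges of the complete graph on `Fin n`. -/
def allPairs (n : ℕ) : Finset (Fin n × Fin n) :=
  Finset.univ.filter (fun p : Fin n × Fin n => p.1 < p.2)

/-- Probability of the edge set `E` under the Erdős–Rényi measure `G(n,p)`. -/
noncomputable def erProb (n : ℕ) (p : ℝ) (E : Finset (Fin n × Fin n)) : ℝ :=
  p ^ E.card * (1 - p) ^ ((allPairs n).card - E.card)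

/-- Size of the connected component of `v` in the graph `(V, E)`. -/
noncomputable def compCard {n : ℕ} (E : Finset (Fin n × Fin n)) (v : Fin n) : ℕ :=
  (Finset.univ.filter (fun u => (graphOf E).Reachable v u)).card

/-- `L₁`: size of the largest connected component. -/
noncomputable def L1 {n : ℕ} (E : Finset (Fin n × Fin n)) : ℕ :=
  Finset.univ.sup (fun v => compCard E v)

/-- Sum of the squares of the component sizes, `Σ_j L_j²`
(computed as `Σ_v |C(v)|`). -/
noncomputable def sumCompSq {n : ℕ} (E : Finset (Fin n × Fin n)) : ℕ :=
  ∑ v : Fin n, compCard E v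

/-- Expectation of `f` under the Erdős–Rényi measure `G(n,p)`. -/
noncomputable def erExp (n : ℕ) (p : ℝ) (f : Finset (Fin n × Fin n) → ℝ) : ℝ :=
  ∑ E ∈ (allPairs n).powerset, erProb n p E * f E

/-- Random-cluster weight of an edge set with parameters `q`, `p = 1 - exp (-β/n)`. -/
noncomputable def rcWeight (n q : ℕ) (β : ℝ) (E : Finset (Fin n × Fin n)) : ℝ :=
  (1 - Real.exp (-(β / n))) ^ E.card *
    Real.exp (-(β / n)) ^ ((allPairs n).card - E.card) * (q : ℝ) ^ numComps E

/-- The mean-field random-cluster measure: probability of the edge set `E`. -/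
noncomputable def rcProb (n q : ℕ) (β : ℝ) (E : Finset (Fin n × Fin n)) : ℝ :=
  rcWeight n q β E / ∑ B ∈ (allPairs n).powerset, rcWeight n q β B

/-- A convexity estimate: `1 - y - exp (-lam * y)` lies on the far side of the parabola
`c * y * (s - y)`, where `s` is a root. -/
theorem survival_defect {lam c s : ℝ} (hc : 2 * c ≤ lam ^ 2 * Real.exp (-lam)) (hlam : 0 ≤ lam)
    (hs0 : 0 < s) (hs1 : s < 1) (hs : Real.exp (-lam * s) = 1 - s) :
    (∀ y, 0 ≤ y → y ≤ s → c * y * (s - y) ≤ 1 - y - Real.exp (-lam * y)) ∧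
    (∀ y, s ≤ y → y ≤ 1 → 1 - y - Real.exp (-lam * y) ≤ c * y * (s - y)) := by
  have hconv : ConvexOn ℝ (Set.Icc (0 : ℝ) 1) (fun y => Real.exp (-lam * y) - c * y ^ 2) := by
    refine convexOn_of_hasDerivWithinAt2_nonneg (convex_Icc 0 1)
      (f' := fun y => -lam * Real.exp (-lam * y) - c * (2 * y))
      (f'' := fun y => lam ^ 2 * Real.exp (-lam * y) - 2 * c) (by fun_prop) ?_ ?_ ?_
    · intro x _
      refine HasDerivAt.hasDerivWithinAt ?_
      have h1 : HasDerivAt (fun y : ℝ => -lam * y) (-lam) x := by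
        simpa using (hasDerivAt_id x).const_mul (-lam)
      have h2 := (h1.exp).sub ((hasDerivAt_pow 2 x).const_mul c)
      refine h2.congr_deriv ?_
      norm_num
      ring
    · intro x _
      refine HasDerivAt.hasDerivWithinAt ?_
      have h1 : HasDerivAt (fun y : ℝ => -lam * y) (-lam) x := by
        simpa using (hasDerivAt_id x).const_mul (-lam)
      have h2 := ((h1.exp).const_mul (-lam)).sub (((hasDerivAt_id x).const_mul 2).const_mul c)
      refine h2.congr_deriv ?_
      ring
    · intro x hx
      rw [interior_Icc] at hx
      have : Real.exp (-lam) ≤ Real.exp (-lam * x) := by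
        apply Real.exp_le_exp.2
        nlinarith [hx.2, hx.1]
      nlinarith [sq_nonneg lam]
  constructor
  · intro y hy0 hys
    have h := hconv.2 (Set.left_mem_Icc.2 zero_le_one) (⟨hs0.le, hs1.le⟩ : s ∈ Set.Icc (0:ℝ) 1)
      (sub_nonneg.2 ((div_le_one hs0).2 hys)) (div_nonneg hy0 hs0.le) (by ring)
    simp only [smul_eq_mul, mul_zero, zero_add, Real.exp_zero, hs] at h
    have e1 : y / s * s = y := by field_simp
    rw [e1] at h
    have e2 : y / s * (1 - s - c * s ^ 2) = y / s - y - c * y * s := by field_simp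
    rw [e2] at h
    nlinarith
  · intro y hsy hy1
    have hy0 : 0 < y := hs0.trans_le hsy
    have h := hconv.2 (Set.left_mem_Icc.2 zero_le_one) (⟨hy0.le, hy1⟩ : y ∈ Set.Icc (0:ℝ) 1)
      (sub_nonneg.2 ((div_le_one hy0).2 hsy)) (div_nonneg hs0.le hy0.le) (by ring)
    simp only [smul_eq_mul, mul_zero, zero_add, Real.exp_zero] at h
    have e1 : s / y * y = s := by field_simp
    rw [e1, hs] at h
    have h2 := mul_le_mul_of_nonneg_left h (div_nonneg hy0.le hs0.le)
    have e2 : y / s * ((1 - s / y) * (1 - c * 0 ^ 2) + s / y * (Real.exp (-lam * y) - c * y ^ 2))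
        = y / s - 1 + Real.exp (-lam * y) - c * y ^ 2 := by field_simp; ring
    have e3 : y / s * (1 - s - c * s ^ 2) = y / s - y - c * y * s := by field_simp
    rw [e2, e3] at h2
    nlinarith

theorem survival_defect_abs {lam c s : ℝ} (hc : 2 * c ≤ lam ^ 2 * Real.exp (-lam))
    (hlam : 0 ≤ lam)
    (hs0 : 0 < s) (hs1 : s < 1) (hs : Real.exp (-lam * s) = 1 - s) {y : ℝ} (hy0 : 0 ≤ y)
    (hy1 : y ≤ 1) : c * y * |s - y| ≤ |1 - y - Real.exp (-lam * y)| := by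
  obtain ⟨h1, h2⟩ := survival_defect hc hlam hs0 hs1 hs
  rcases le_total y s with h | h
  · rw [abs_of_nonneg (sub_nonneg.2 h)]
    exact (h1 y hy0 h).trans (le_abs_self _)
  · rw [abs_of_nonpos (sub_nonpos.2 h)]
    have := h2 y h hy1
    have h3 := neg_le_abs (1 - y - Real.exp (-lam * y))
    nlinarith

theorem exists_survival_root {lam : ℝ} (hlam : 1 < lam) :
    ∃ x ∈ Set.Ioo (0 : ℝ) 1, Real.exp (-lam * x) = 1 - x := by
  set y₀ := (lam - 1) / (2 * lam) with hy₀
  have hl : 0 < lam := by linarith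
  have hy0 : 0 < y₀ := div_pos (by linarith) (by linarith)
  have hy1 : y₀ < 1 := by rw [hy₀, div_lt_one (by linarith)]; linarith
  have hpos : 0 < 1 - y₀ - Real.exp (-lam * y₀) := by
    have h1 : 1 + lam * y₀ ≤ Real.exp (lam * y₀) := by linarith [Real.add_one_le_exp (lam * y₀)]
    have h2 : Real.exp (-lam * y₀) ≤ 1 / (1 + lam * y₀) := by
      rw [neg_mul, Real.exp_neg, ← one_div]
      exact one_div_le_one_div_of_le (by positivity) h1
    have h3 : 1 / (1 + lam * y₀) < 1 - y₀ := by
      rw [div_lt_iff₀ (by positivity)]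
      have : lam * y₀ = (lam - 1) / 2 := by rw [hy₀]; field_simp
      nlinarith
    linarith
  have hneg : 1 - 1 - Real.exp (-lam * 1) < 0 := by
    have := Real.exp_pos (-lam * 1)
    linarith
  have hcont : ContinuousOn (fun y => 1 - y - Real.exp (-lam * y)) (Set.Icc y₀ 1) := by fun_prop
  obtain ⟨x, hx, hx'⟩ := intermediate_value_Icc' hy1.le hcont ⟨hneg.le, hpos.le⟩
  refine ⟨x, ⟨by linarith [hx.1], lt_of_le_of_ne hx.2 ?_⟩, by linarith⟩
  rintro rfl
  simp only at hx'
  linarith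

theorem theta_spec {lam : ℝ} (hlam : 1 < lam) :
    theta lam ∈ Set.Ioo (0 : ℝ) 1 ∧ Real.exp (-lam * theta lam) = 1 - theta lam := by
  obtain ⟨x, hx, hxr⟩ := exists_survival_root hlam
  have : {x : ℝ | x ∈ Set.Ioo (0 : ℝ) 1 ∧ Real.exp (-lam * x) = 1 - x} = {x} := by
    ext y
    simp only [Set.mem_ofPred_eq, Set.mem_singleton_iff]
    refine ⟨fun ⟨hy, hyr⟩ => ?_, fun h => h ▸ ⟨hx, hxr⟩⟩
    have hc : 0 < lam ^ 2 * Real.exp (-lam) / 2 := by positivity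
    have h := survival_defect_abs (c := lam ^ 2 * Real.exp (-lam) / 2) (by linarith)
      (by linarith) hx.1 hx.2 hxr hy.1.le hy.2.le
    rw [hyr, sub_self, abs_zero] at h
    have h2 : |x - y| ≤ 0 := by
      by_contra hcon
      push Not at hcon
      have := mul_pos (mul_pos hc hy.1) hcon
      linarith
    have := abs_nonpos_iff.1 h2
    linarith
  have ht : theta lam = x := by
    rw [theta, if_neg (not_le.2 hlam), this, csSup_singleton]
  rw [ht]
  exact ⟨hx, hxr⟩

theorem sq_mul_one_sub_theta_le {lam : ℝ} (hlam : 1 < lam) :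
    lam ^ 2 * (1 - theta lam) ≤ 1 := by
  obtain ⟨⟨h0, h1⟩, hr⟩ := theta_spec hlam
  set s := theta lam
  have hm : 0 ≤ lam * s / 2 := by positivity
  have h := Real.self_le_sinh_iff.2 hm
  rw [Real.sinh_eq] at h
  set u := Real.exp (-(lam * s / 2)) with hu
  have hu0 : 0 < u := Real.exp_pos _
  have hv : Real.exp (lam * s / 2) * u = 1 := by rw [hu, ← Real.exp_add]; simp
  have hu2 : u ^ 2 = 1 - s := by
    rw [← hr, hu, ← Real.exp_nat_mul]; congr 1; push_cast; ring
  have h3 : lam * s * u ≤ s := by nlinarith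
  have h4 : lam * u ≤ 1 := by
    by_contra hcon
    push Not at hcon
    nlinarith
  have h5 : 0 ≤ lam * u := by positivity
  rw [← hu2]
  nlinarith

theorem theta_lipschitz {L lam lam₀ : ℝ} (h : 1 < lam) (h₀ : 1 < lam₀) (hL : lam ≤ L) :
    |theta lam - theta lam₀| ≤ 2 * Real.exp L * |lam - lam₀| := by
  obtain ⟨⟨a0, a1⟩, ar⟩ := theta_spec h
  obtain ⟨⟨b0, b1⟩, br⟩ := theta_spec h₀
  set s := theta lam
  set t := theta lam₀
  have hc : 2 * (Real.exp (-L) / 2) ≤ lam ^ 2 * Real.exp (-lam) := by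
    have h1 : Real.exp (-L) ≤ Real.exp (-lam) := Real.exp_le_exp.2 (by linarith)
    have h2 := Real.exp_pos (-lam)
    have h3 : 1 ≤ lam ^ 2 := one_le_pow₀ h.le
    nlinarith
  have h1 := survival_defect_abs hc (by linarith) a0 a1 ar b0.le b1.le
  have h2 : |1 - t - Real.exp (-lam * t)| ≤ t * |lam - lam₀| := by
    rw [← br]
    have key : ∀ x y : ℝ, 0 ≤ x → 0 ≤ y → |Real.exp (-x) - Real.exp (-y)| ≤ |x - y| := by
      have key' : ∀ x y : ℝ, 0 ≤ x → x ≤ y → |Real.exp (-x) - Real.exp (-y)| ≤ |x - y| := by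
        intro x y hx hxy
        have e1 : Real.exp (-y) = Real.exp (-x) * Real.exp (-(y - x)) := by
          rw [← Real.exp_add]; congr 1; ring
        have e2 := Real.one_sub_le_exp_neg (y - x)
        have e3 : Real.exp (-x) ≤ 1 := Real.exp_le_one_iff.2 (by linarith)
        have e4 := Real.exp_pos (-x)
        have e5 : Real.exp (-(y - x)) ≤ 1 := Real.exp_le_one_iff.2 (by linarith)
        rw [abs_of_nonneg (by rw [e1]; nlinarith), abs_of_nonpos (by linarith), e1]
        nlinarith
      intro x y hx hy
      rcases le_total x y with hxy | hxy
      · exact key' x y hx hxy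
      · rw [abs_sub_comm, abs_sub_comm x]; exact key' y x hy hxy
    have := key (lam₀ * t) (lam * t) (by positivity) (by positivity)
    rw [neg_mul, neg_mul]
    refine this.trans (le_of_eq ?_)
    rw [← sub_mul, abs_mul, abs_of_pos b0, abs_sub_comm, mul_comm]
  have h3 : t * (Real.exp (-L) / 2 * |s - t|) ≤ t * |lam - lam₀| := by linarith
  have h4 := le_of_mul_le_mul_left h3 b0
  have h5 : Real.exp L * Real.exp (-L) = 1 := by rw [← Real.exp_add]; simp
  have h6 := mul_le_mul_of_nonneg_left h4 (by positivity : 0 ≤ 2 * Real.exp L)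
  calc |s - t| = 2 * Real.exp L * (Real.exp (-L) / 2 * |s - t|) := by
        linear_combination (-|s-t|) * h5
    _ ≤ _ := h6

theorem abs_exp_neg_sub_sub_le {a b : ℝ} (ha : 0 ≤ a) (hb : 0 ≤ b) :
    |Real.exp (-a) - Real.exp (-b) - Real.exp (-a) * (b - a)| ≤ (b - a) ^ 2 := by
  have e1 : Real.exp (-b) = Real.exp (-a) * Real.exp (-(b - a)) := by
    rw [← Real.exp_add]; congr 1; ring
  have e3 : Real.exp (-a) ≤ 1 := Real.exp_le_one_iff.2 (by linarith)
  have e3' : Real.exp (-b) ≤ 1 := Real.exp_le_one_iff.2 (by linarith)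
  have e4 := Real.exp_pos (-a)
  have e4' := Real.exp_pos (-b)
  set d := b - a with hd
  have hlow := Real.one_sub_le_exp_neg d
  have e0 : Real.exp (-a) - Real.exp (-b) - Real.exp (-a) * d
      = -(Real.exp (-a) * (Real.exp (-d) - 1 - -d)) := by rw [e1]; ring
  rw [e0, abs_neg, abs_mul, abs_of_pos e4]
  by_cases h : |-d| ≤ 1
  · have := Real.abs_exp_sub_one_sub_id_le h
    have h0 := abs_nonneg (Real.exp (-d) - 1 - -d)
    nlinarith
  · rw [abs_of_nonneg (by linarith)]
    rw [abs_neg, not_le, lt_abs] at h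
    rcases h with h | h
    · have : Real.exp (-d) ≤ 1 := Real.exp_le_one_iff.2 (by linarith)
      nlinarith
    · nlinarith

/-- Second order expansion of `lam ↦ lam * theta lam`. -/
theorem mul_theta_expansion {L lam lam₀ : ℝ} (h : 1 < lam) (h₀ : 1 < lam₀) (hL : lam ≤ L)
    (hL₀ : lam₀ ≤ L) :
    |(1 - lam₀ * (1 - theta lam₀)) * (lam * theta lam - lam₀ * theta lam₀)
      - theta lam₀ * (lam - lam₀)| ≤
      (2 * Real.exp L + L * (1 + L * (2 * Real.exp L)) ^ 2) * (lam - lam₀) ^ 2 := by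
  have hl := theta_lipschitz h h₀ hL
  obtain ⟨⟨a0, a1⟩, ar⟩ := theta_spec h
  obtain ⟨⟨b0, b1⟩, br⟩ := theta_spec h₀
  set s := theta lam
  set t := theta lam₀
  have hmu : |lam * s - lam₀ * t| ≤ (1 + L * (2 * Real.exp L)) * |lam - lam₀| := by
    have : lam * s - lam₀ * t = (lam - lam₀) * s + lam₀ * (s - t) := by ring
    rw [this]
    refine (abs_add_le _ _).trans ?_
    rw [abs_mul, abs_mul, abs_of_pos a0, abs_of_pos (by linarith : 0 < lam₀)]
    have h1 := abs_nonneg (lam - lam₀)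
    have h2 := abs_nonneg (s - t)
    have h3 : lam₀ * |s - t| ≤ L * (2 * Real.exp L * |lam - lam₀|) :=
      mul_le_mul hL₀ hl h2 (by linarith)
    nlinarith
  have hr := abs_exp_neg_sub_sub_le (a := lam₀ * t) (b := lam * s) (by positivity) (by positivity)
  rw [← neg_mul, ← neg_mul, ar, br] at hr
  have key : (1 - lam₀ * (1 - t)) * (lam * s - lam₀ * t) - t * (lam - lam₀)
      = (lam - lam₀) * (s - t)
        + lam₀ * (1 - t - (1 - s) - (1 - t) * (lam * s - lam₀ * t)) := by ring
  rw [key]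
  refine (abs_add_le _ _).trans ?_
  rw [abs_mul, abs_mul, abs_of_pos (by linarith : 0 < lam₀)]
  have h1 := abs_nonneg (lam - lam₀)
  have h5 : (lam * s - lam₀ * t) ^ 2
      ≤ (1 + L * (2 * Real.exp L)) ^ 2 * (lam - lam₀) ^ 2 := by
    rw [← mul_pow, ← sq_abs (lam * s - lam₀ * t), ← sq_abs ((1 + L * (2 * Real.exp L)) * _)]
    refine pow_le_pow_left₀ (abs_nonneg _) (hmu.trans ?_) 2
    rw [abs_mul]
    gcongr
    exact le_abs_self _
  have h6 : lam₀ * |1 - t - (1 - s) - (1 - t) * (lam * s - lam₀ * t)|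
      ≤ L * ((1 + L * (2 * Real.exp L)) ^ 2 * (lam - lam₀) ^ 2) :=
    mul_le_mul hL₀ (hr.trans h5) (abs_nonneg _) (by linarith)
  have h7 : |lam - lam₀| * |s - t| ≤ 2 * Real.exp L * (lam - lam₀) ^ 2 := by
    rw [← sq_abs (lam - lam₀)]
    nlinarith
  linarith

theorem continuousOn_theta : ContinuousOn theta (Set.Ioi 1) := by
  intro x hx
  refine ContinuousAt.continuousWithinAt ?_
  have hx : (1 : ℝ) < x := hx
  have hev : ∀ᶠ y in nhds x, |theta y - theta x| ≤ 2 * Real.exp (x + 1) * |y - x| := by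
    filter_upwards [Ioo_mem_nhds hx (lt_add_one x)] with y hy
    exact theta_lipschitz hy.1 hx hy.2.le
  rw [ContinuousAt, tendsto_iff_dist_tendsto_zero]
  refine squeeze_zero' (g := fun y => 2 * Real.exp (x + 1) * |y - x|)
    (Filter.Eventually.of_forall fun _ => dist_nonneg)
    (hev.mono fun y hy => by rw [Real.dist_eq]; exact hy) ?_
  have : ContinuousAt (fun y => 2 * Real.exp (x + 1) * |y - x|) x := by fun_prop
  simpa using this.tendsto

theorem aFix_spec {q : ℕ} (hq : 2 ≤ q) {β : ℝ} (hβ : (q : ℝ) < β) :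
    1 / (q : ℝ) < aFix q β ∧ aFix q β ≤ 1 ∧ F q β (aFix q β) = aFix q β := by
  have hq2 : (2 : ℝ) ≤ q := by exact_mod_cast hq
  have hq0 : (0 : ℝ) < q := by linarith
  have hq1 : 1 / (q : ℝ) < 1 := by rw [div_lt_one hq0]; linarith
  have hqi : 0 < 1 / (q : ℝ) := by positivity
  have hlam : ∀ x, 1 / (q : ℝ) ≤ x → 1 < β * x := by
    intro x hx
    have h1 : 1 < β * (1 / q) := by rw [mul_one_div, one_lt_div hq0]; exact hβ
    nlinarith
  have hcont : ContinuousOn (F q β) (Set.Icc (1 / (q : ℝ)) 1) := by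
    unfold F
    have : ContinuousOn (fun x => theta (β * x)) (Set.Icc (1 / (q : ℝ)) 1) :=
      continuousOn_theta.comp (by fun_prop) (fun x hx => hlam x hx.1)
    fun_prop
  have hF0 : 1 / (q : ℝ) < F q β (1 / q) := by
    have h := (theta_spec (hlam _ le_rfl)).1.1
    have : 0 < (1 - 1 / (q : ℝ)) * theta (β * (1 / q)) * (1 / q) := by
      have : 0 < 1 - 1 / (q : ℝ) := by linarith
      positivity
    unfold F
    linarith
  have hF1 : F q β 1 ≤ 1 := by
    have h := (theta_spec (hlam 1 hq1.le)).1.2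
    have h0 := (theta_spec (hlam 1 hq1.le)).1.1
    unfold F
    nlinarith
  have hset : {x : ℝ | x ∈ Set.Ioc (1 / (q : ℝ)) 1 ∧ F q β x = x}
      = {x ∈ Set.Icc (1 / (q : ℝ)) 1 | F q β x - x = 0} := by
    ext x
    simp only [Set.mem_ofPred_eq, Set.mem_Ioc, Set.mem_Icc, sub_eq_zero]
    constructor
    · rintro ⟨h, h'⟩; exact ⟨⟨h.1.le, h.2⟩, h'⟩
    · rintro ⟨h, h'⟩
      refine ⟨⟨lt_of_le_of_ne h.1 ?_, h.2⟩, h'⟩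
      rintro rfl
      exact absurd h' hF0.ne'
  have hcont2 : ContinuousOn (fun x => F q β x - x) (Set.Icc (1 / (q : ℝ)) 1) := by fun_prop
  have hmem : aFix q β ∈ {x : ℝ | x ∈ Set.Ioc (1 / (q : ℝ)) 1 ∧ F q β x = x} := by
    unfold aFix
    refine IsCompact.sSup_mem ?_ ?_
    · rw [hset]
      have hcl : IsClosed ({x ∈ Set.Icc (1 / (q : ℝ)) 1 | F q β x - x = 0}) := by
        have := hcont2.preimage_isClosed_of_isClosed isClosed_Icc (isClosed_singleton (x := 0))
        convert this using 1
        ext x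
        simp
      exact isCompact_Icc.of_isClosed_subset hcl (Set.sep_subset _ _)
    · rw [hset]
      obtain ⟨x, hx, hx'⟩ := intermediate_value_Icc' hq1.le hcont2
        (⟨by linarith, by linarith⟩ : (0 : ℝ) ∈ Set.Icc _ _)
      exact ⟨x, hx, hx'⟩
  exact ⟨hmem.1.1, hmem.1.2, hmem.2⟩

theorem drift_expansion {q : ℕ} (hq : 2 ≤ q) {β : ℝ} (hβ : (q : ℝ) < β) :
    1 < β * aFix q β ∧ β * ((1 - aFix q β) / ((q : ℝ) - 1)) < 1 ∧
    0 < deriv (F q β) (aFix q β) ∧ deriv (F q β) (aFix q β) < 1 ∧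
    ∃ K η : ℝ, 0 ≤ K ∧ 0 < η ∧ ∀ x, |x - aFix q β| ≤ η →
      1 < β * x ∧ |F q β x - aFix q β| ≤
        deriv (F q β) (aFix q β) * |x - aFix q β| + K * (x - aFix q β) ^ 2 := by
  obtain ⟨ha, ha1, haF⟩ := aFix_spec hq hβ
  set a := aFix q β
  have hq2 : (2 : ℝ) ≤ q := by exact_mod_cast hq
  have hq0 : (0 : ℝ) < q := by linarith
  have hβ0 : 0 < β := by linarith
  have hqi : 0 < 1 / (q : ℝ) := by positivity
  have hqh : 1 / (q : ℝ) ≤ 1 / 2 := one_div_le_one_div_of_le (by norm_num) hq2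
  have hqq : (q : ℝ) * (1 / q) = 1 := by field_simp
  have hlam₀ : 1 < β * a := by nlinarith
  have hsq := sq_mul_one_sub_theta_le hlam₀
  obtain ⟨⟨t0, t1⟩, tr⟩ := theta_spec hlam₀
  have haF' : 1 / (q : ℝ) + (1 - 1 / q) * theta (β * a) * a = a := haF
  set t := theta (β * a) with ht
  set k := 1 - 1 / (q : ℝ) with hk
  have hk0 : 1 / 2 ≤ k := by linarith
  have hk00 : 0 < k := by linarith
  have ha0 : 0 < a := hqi.trans ha
  set D := 1 - β * a * (1 - t) with hD
  have hdual : β * a * (β * a * (1 - t)) ≤ 1 := by nlinarith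
  have hdual1 : β * a * (1 - t) < 1 := by
    by_contra hcon
    push Not at hcon
    nlinarith
  have hD0 : 0 < D := by linarith
  have ha' : a * (1 - k * t) = 1 / q := by linear_combination (-1 : ℝ) * haF'
  have hkt : k * t < D := by
    have h1 : 1 < β * a * (1 - k * t) := by
      rw [mul_assoc, ha']
      nlinarith
    have h2 : β * a * (1 - k * t) > β * a * (β * a * (1 - t)) := by linarith
    have h3 := lt_of_mul_lt_mul_left h2 (by linarith)
    linarith
  set η := min ((β * a - 1) / (2 * β)) 1 with hη
  have hη0 : 0 < η := lt_min (div_pos (by linarith) (by linarith)) one_pos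
  set L := β * (a + 1) with hL
  have hx : ∀ x, |x - a| ≤ η → 1 < β * x ∧ β * x ≤ L := by
    intro x hx
    have h1 := abs_le.1 (hx.trans (min_le_left _ _))
    have h2 := abs_le.1 (hx.trans (min_le_right _ _))
    constructor
    · have h3 : β * ((β * a - 1) / (2 * β)) = (β * a - 1) / 2 := by field_simp
      nlinarith
    · rw [hL]; exact mul_le_mul_of_nonneg_left (by linarith) hβ0.le
  set K := k / β / D * ((2 * Real.exp L + L * (1 + L * (2 * Real.exp L)) ^ 2) * β ^ 2) with hK
  have hL0 : 0 ≤ L := by positivity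
  have hK0 : 0 ≤ K := by positivity
  have hquad : ∀ x, |x - a| ≤ η → |F q β x - a - k * t / D * (x - a)| ≤ K * (x - a) ^ 2 := by
    intro x hxa
    obtain ⟨h1, h2⟩ := hx x hxa
    have h3 := mul_theta_expansion h1 hlam₀ h2 (by rw [hL]; nlinarith)
    rw [← ht, ← hD] at h3
    have hFx : F q β x = 1 / q + k / β * (β * x * theta (β * x)) := by
      change 1 / (q : ℝ) + k * theta (β * x) * x = _
      field_simp
    have hFa : a = 1 / q + k / β * (β * a * t) := by
      have : k / β * (β * a * t) = k * t * a := by field_simp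
      rw [this]; linarith
    have e : F q β x - a - k * t / D * (x - a)
        = k / β / D * (D * (β * x * theta (β * x) - β * a * t) - t * (β * x - β * a)) := by
      rw [hFx]
      nth_rewrite 1 [hFa]
      field_simp
      ring
    rw [e, abs_mul, abs_of_nonneg (by positivity : 0 ≤ k / β / D), hK, mul_assoc (k / β / D)]
    refine mul_le_mul_of_nonneg_left (h3.trans (le_of_eq ?_)) (by positivity)
    ring
  have hderiv : HasDerivAt (F q β) (k * t / D) a := by
    rw [hasDerivAt_iff_isLittleO]
    have hO : (fun x => F q β x - F q β a - (x - a) • (k * t / D)) =O[nhds a]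
        (fun x => (x - a) ^ 2) := by
      refine Asymptotics.IsBigO.of_bound K ?_
      filter_upwards [Metric.closedBall_mem_nhds a hη0] with x hxa
      rw [Metric.mem_closedBall, Real.dist_eq] at hxa
      have := hquad x hxa
      rw [haF, smul_eq_mul, mul_comm (x - a), Real.norm_eq_abs, Real.norm_eq_abs,
        abs_of_nonneg (sq_nonneg (x - a))]
      exact this
    refine hO.trans_isLittleO ?_
    have h1 : (fun x : ℝ => (x - a)) =o[nhds a] (fun _ => (1 : ℝ)) := by
      rw [Asymptotics.isLittleO_one_iff]
      have : ContinuousAt (fun x : ℝ => x - a) a := by fun_prop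
      simpa [ContinuousAt] using this
    have h2 := (Asymptotics.isBigO_refl (fun x : ℝ => x - a) (nhds a)).mul_isLittleO h1
    simpa [pow_two] using h2
  rw [hderiv.deriv]
  refine ⟨hlam₀, ?_, by positivity, (div_lt_one hD0).2 hkt, K, η, hK0, hη0, fun x hxa =>
    ⟨(hx x hxa).1, ?_⟩⟩
  · have : (1 - a) / ((q : ℝ) - 1) = a * (1 - t) := by
      rw [div_eq_iff (by linarith)]
      have h2 : (q : ℝ) * (1 / q + k * t * a) = q * a := by rw [haF']
      rw [hk] at h2
      field_simp at h2
      linarith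
    rw [this, ← mul_assoc]
    exact hdual1
  · have h1 := hquad x hxa
    have h2 : F q β x - a = (F q β x - a - k * t / D * (x - a)) + k * t / D * (x - a) := by ring
    rw [h2]
    refine (abs_add_le _ _).trans ?_
    rw [abs_mul, abs_of_pos (by positivity : 0 < k * t / D)]
    linarith

/-- Expectation under bond percolation on the edge set `M` with closing probability `r`. -/
noncomputable def percExp {n : ℕ} (M : Finset (Fin n × Fin n)) (r : ℝ)
    (f : Finset (Fin n × Fin n) → ℝ) : ℝ :=
  ∑ E ∈ M.powerset, ((1 - r) ^ E.card * r ^ (M.card - E.card)) * f E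

/-- The set of vertices connected to some vertex of `S` in the graph with edge set `E`. -/
noncomputable def clus {n : ℕ} (E : Finset (Fin n × Fin n)) (S : Finset (Fin n)) :
    Finset (Fin n) :=
  Finset.univ.filter (fun u => ∃ s ∈ S, (graphOf E).Reachable s u)

section percExp
variable {n : ℕ} {M : Finset (Fin n × Fin n)} {r : ℝ}

theorem percExp_one (M : Finset (Fin n × Fin n)) (r : ℝ) : percExp M r (fun _ => 1) = 1 := by
  simp [percExp, Finset.sum_pow_mul_eq_add_pow]

theorem percExp_mono (h0 : 0 ≤ r) (h1 : r ≤ 1) {f g : Finset (Fin n × Fin n) → ℝ}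
    (h : ∀ E ∈ M.powerset, f E ≤ g E) : percExp M r f ≤ percExp M r g := by
  refine Finset.sum_le_sum fun E hE => mul_le_mul_of_nonneg_left (h E hE) ?_
  have : 0 ≤ 1 - r := by linarith
  positivity

theorem percExp_add (f g : Finset (Fin n × Fin n) → ℝ) :
    percExp M r (fun E => f E + g E) = percExp M r f + percExp M r g := by
  simp [percExp, mul_add, Finset.sum_add_distrib]

theorem percExp_const_mul (c : ℝ) (f : Finset (Fin n × Fin n) → ℝ) :
    percExp M r (fun E => c * f E) = c * percExp M r f := by
  simp only [percExp, Finset.mul_sum]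
  exact Finset.sum_congr rfl fun E _ => by ring

theorem percExp_const (c : ℝ) : percExp M r (fun _ => c) = c := by
  have := percExp_const_mul (M := M) (r := r) c (fun _ => 1)
  rw [percExp_one] at this
  simpa using this

theorem percExp_sum {ι : Type*} (s : Finset ι) (f : ι → Finset (Fin n × Fin n) → ℝ) :
    percExp M r (fun E => ∑ i ∈ s, f i E) = ∑ i ∈ s, percExp M r (f i) := by
  simp only [percExp, Finset.mul_sum]
  exact Finset.sum_comm

end percExp

theorem sum_powerset_split {α : Type*} [DecidableEq α] (M : Finset α) (P : α → Prop)
    (g : Finset α → ℝ) :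
    ∑ E ∈ M.powerset, g E = ∑ E₁ ∈ (M.filter P).powerset,
      ∑ E₂ ∈ (M.filter (fun e => ¬ P e)).powerset, g (E₁ ∪ E₂) := by
  rw [← Finset.sum_product']
  refine Finset.sum_nbij' (fun E => (E.filter P, E.filter (fun e => ¬ P e)))
    (fun p => p.1 ∪ p.2) ?_ ?_ ?_ ?_ ?_
  · intro E hE
    rw [Finset.mem_powerset] at hE
    simp only [Finset.mem_product, Finset.mem_powerset]
    exact ⟨Finset.filter_subset_filter _ hE, Finset.filter_subset_filter _ hE⟩
  · rintro ⟨E₁, E₂⟩ h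
    simp only [Finset.mem_product, Finset.mem_powerset] at h ⊢
    exact Finset.union_subset (h.1.trans (Finset.filter_subset _ _))
      (h.2.trans (Finset.filter_subset _ _))
  · intro E _
    exact Finset.filter_union_filter_not_eq _ _
  · rintro ⟨E₁, E₂⟩ h
    simp only [Finset.mem_product, Finset.mem_powerset] at h
    have h1 : ∀ e ∈ E₁, P e := fun e he => (Finset.mem_filter.1 (h.1 he)).2
    have h2 : ∀ e ∈ E₂, ¬ P e := fun e he => (Finset.mem_filter.1 (h.2 he)).2
    ext e <;> simp only [Finset.mem_filter, Finset.mem_union]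
    · constructor
      · rintro ⟨h3 | h3, h4⟩
        · exact h3
        · exact absurd h4 (h2 e h3)
      · exact fun h3 => ⟨Or.inl h3, h1 e h3⟩
    · constructor
      · rintro ⟨h3 | h3, h4⟩
        · exact absurd (h1 e h3) h4
        · exact h3
      · exact fun h3 => ⟨Or.inr h3, h2 e h3⟩
  · intro E _
    rw [Finset.filter_union_filter_not_eq]

section clus
variable {n : ℕ} {E : Finset (Fin n × Fin n)} {S W : Finset (Fin n)}

theorem graphOf_adj {u v : Fin n} :
    (graphOf E).Adj u v ↔ u ≠ v ∧ ((u, v) ∈ E ∨ (v, u) ∈ E) :=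
  SimpleGraph.fromRel_adj _ _ _

theorem mem_clus {u : Fin n} : u ∈ clus E S ↔ ∃ s ∈ S, (graphOf E).Reachable s u := by
  simp [clus]

theorem subset_clus : S ⊆ clus E S := fun s hs =>
  mem_clus.2 ⟨s, hs, SimpleGraph.Reachable.refl s⟩

theorem clus_closed {u v : Fin n} (hu : u ∈ clus E S) (h : (u, v) ∈ E ∨ (v, u) ∈ E) :
    v ∈ clus E S := by
  rcases eq_or_ne u v with rfl | hne
  · exact hu
  · obtain ⟨s, hs, hsu⟩ := mem_clus.1 hu
    exact mem_clus.2 ⟨s, hs, hsu.trans (SimpleGraph.Adj.reachable (graphOf_adj.2 ⟨hne, h⟩))⟩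

theorem clus_subset_of_closed (hS : S ⊆ W)
    (hW : ∀ u v, (u, v) ∈ E → (u ∈ W ↔ v ∈ W)) : clus E S ⊆ W := by
  intro u hu
  obtain ⟨s, hs, ⟨p⟩⟩ := mem_clus.1 hu
  have hs' := hS hs
  clear hs hu
  induction p with
  | nil => exact hs'
  | cons h p ih =>
    apply ih
    rcases (graphOf_adj.1 h).2 with h | h
    · exact (hW _ _ h).1 hs'
    · exact (hW _ _ h).2 hs'

theorem clus_mono {E' : Finset (Fin n × Fin n)} (h : E ⊆ E') : clus E S ⊆ clus E' S := by
  intro u hu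
  obtain ⟨s, hs, hr⟩ := mem_clus.1 hu
  refine mem_clus.2 ⟨s, hs, hr.mono ?_⟩
  intro a b hab
  rw [graphOf_adj] at hab ⊢
  exact ⟨hab.1, hab.2.imp (fun x => h x) (fun x => h x)⟩

end clus

theorem mem_monoPairs {n q : ℕ} {X : Conf n q} {e : Fin n × Fin n} :
    e ∈ monoPairs X ↔ e.1 < e.2 ∧ X e.1 = X e.2 := by
  simp [monoPairs]

/-- A cluster of percolation on monochromatic pairs stays in its colour class. -/
theorem clus_color {n q : ℕ} {X : Conf n q} {E : Finset (Fin n × Fin n)}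
    (hE : E ⊆ monoPairs X) {S : Finset (Fin n)} {i : Fin q} (hS : ∀ v ∈ S, X v = i) :
    ∀ v ∈ clus E S, X v = i := by
  have : clus E S ⊆ Finset.univ.filter (fun v => X v = i) := by
    refine clus_subset_of_closed (fun v hv => by simp [hS v hv]) ?_
    intro u v huv
    have := (mem_monoPairs.1 (hE huv)).2
    simp only at this
    simp [this]
  intro v hv
  simpa using this hv

/-- The monochromatic pairs with one end in `C` and the other in `T`. -/
noncomputable def crossing {n q : ℕ} (X : Conf n q) (C T : Finset (Fin n)) :
    Finset (Fin n × Fin n) :=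
  (monoPairs X).filter (fun e => (e.1 ∈ C ∧ e.2 ∈ T) ∨ (e.1 ∈ T ∧ e.2 ∈ C))

theorem card_crossing {n q : ℕ} {X : Conf n q} {C T : Finset (Fin n)} {i : Fin q}
    (hC : ∀ v ∈ C, X v = i) (hT : ∀ v ∈ T, X v = i) (hd : Disjoint C T) :
    (crossing X C T).card = T.card * C.card := by
  rw [mul_comm, ← Finset.card_product]
  symm
  have hne : ∀ c ∈ C, ∀ t ∈ T, c ≠ t := fun c hc t ht h =>
    Finset.disjoint_left.1 hd hc (h ▸ ht)
  refine Finset.card_bij (fun p _ => if p.1 < p.2 then (p.1, p.2) else (p.2, p.1)) ?_ ?_ ?_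
  · rintro ⟨c, t⟩ h
    rw [Finset.mem_product] at h
    obtain ⟨hc, ht⟩ := h
    simp only at hc ht
    have hct := hne c hc t ht
    rw [crossing, Finset.mem_filter, mem_monoPairs]
    by_cases hlt : c < t
    · simp [hlt, hc, ht, hC c hc, hT t ht]
    · have : t < c := lt_of_le_of_ne (not_lt.1 hlt) hct.symm
      simp [hlt, hc, ht, hC c hc, hT t ht, this]
  · rintro ⟨c, t⟩ h ⟨c', t'⟩ h' heq
    rw [Finset.mem_product] at h h'
    have h1 := hne c h.1 t' h'.2
    have h2 := hne c' h'.1 t h.2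
    simp only at heq
    split_ifs at heq <;> simp only [Prod.mk.injEq] at heq ⊢ <;> tauto
  · rintro ⟨u, v⟩ h
    rw [crossing, Finset.mem_filter, mem_monoPairs] at h
    obtain ⟨⟨hlt, _⟩, h | h⟩ := h <;> simp only at h hlt
    · exact ⟨(u, v), Finset.mem_product.2 ⟨h.1, h.2⟩, by simp [hlt]⟩
    · exact ⟨(v, u), Finset.mem_product.2 ⟨h.2, h.1⟩, by simp [hlt.not_gt]⟩

/-- Adding edges that all touch `T` leaves the cluster of `S` away from `T` exactly when none of
these edges joins `T` to the cluster; in this case the cluster does not change. -/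
theorem clus_union_avoid {n q : ℕ} {X : Conf n q} {S T : Finset (Fin n)}
    (hd : Disjoint S T) {E₁ E₂ : Finset (Fin n × Fin n)}
    (h₁ : ∀ e ∈ E₁, e.1 ∉ T ∧ e.2 ∉ T) (h₂ : ∀ e ∈ E₂, ¬ (e.1 ∉ T ∧ e.2 ∉ T))
    (hE₂ : E₂ ⊆ monoPairs X) :
    (Disjoint T (clus (E₁ ∪ E₂) S) ↔ Disjoint E₂ (crossing X (clus E₁ S) T)) ∧
    (Disjoint T (clus (E₁ ∪ E₂) S) → clus (E₁ ∪ E₂) S = clus E₁ S) ∧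
    Disjoint (clus E₁ S) T := by
  have hCT : Disjoint (clus E₁ S) T := by
    have : clus E₁ S ⊆ Tᶜ := by
      refine clus_subset_of_closed (fun s hs => ?_) fun u v huv => ?_
      · exact Finset.mem_compl.2 (Finset.disjoint_left.1 hd hs)
      · simp [(h₁ _ huv).1, (h₁ _ huv).2]
    exact Finset.disjoint_left.2 fun u hu hT => Finset.mem_compl.1 (this hu) hT
  have hforward : Disjoint T (clus (E₁ ∪ E₂) S) → Disjoint E₂ (crossing X (clus E₁ S) T) := by
    intro hdis
    rw [Finset.disjoint_left] at hdis ⊢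
    rintro ⟨u, v⟩ he hcr
    have hmem : (u, v) ∈ E₁ ∪ E₂ := Finset.mem_union_right _ he
    obtain ⟨_, ⟨hu, hv⟩ | ⟨hu, hv⟩⟩ := Finset.mem_filter.1 hcr
    · exact hdis hv (clus_closed (clus_mono Finset.subset_union_left hu) (Or.inl hmem))
    · exact hdis hu (clus_closed (clus_mono Finset.subset_union_left hv) (Or.inr hmem))
  have hback : Disjoint E₂ (crossing X (clus E₁ S) T) →
      clus (E₁ ∪ E₂) S = clus E₁ S := by
    intro hdis
    refine subset_antisymm (clus_subset_of_closed subset_clus ?_)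
      (clus_mono Finset.subset_union_left)
    intro u v huv
    rcases Finset.mem_union.1 huv with huv | huv
    · exact ⟨fun h => clus_closed h (Or.inl huv), fun h => clus_closed h (Or.inr huv)⟩
    · have hnc := Finset.disjoint_left.1 hdis huv
      rw [crossing, Finset.mem_filter, not_and] at hnc
      have hnc := hnc (hE₂ huv)
      have ht := h₂ _ huv
      simp only at hnc ht
      have hdl : ∀ w, w ∈ clus E₁ S → w ∉ T := fun w hw => Finset.disjoint_left.1 hCT hw
      have := hdl u
      have := hdl v
      tauto
  refine ⟨⟨hforward, fun h => ?_⟩, fun h => hback (hforward h), hCT⟩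
  rw [hback h]
  exact hCT.symm

theorem percExp_avoid {n q : ℕ} (X : Conf n q) {i : Fin q} {S T : Finset (Fin n)}
    (hS : ∀ v ∈ S, X v = i) (hT : ∀ v ∈ T, X v = i) (hd : Disjoint S T) {r : ℝ} (hr : 0 < r) :
    percExp (monoPairs X) r (fun E => if Disjoint T (clus E S) then
      (r⁻¹) ^ (T.card * (clus E S).card) else 0) = 1 := by
  set M := monoPairs X with hM
  obtain ⟨P, hP⟩ : ∃ P : Fin n × Fin n → Prop, ∀ e, P e ↔ (e.1 ∉ T ∧ e.2 ∉ T) :=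
    ⟨_, fun _ => Iff.rfl⟩
  set M₁ := M.filter P with hM₁
  set M₂ := M.filter (fun e => ¬ P e) with hM₂
  have hcard : M.card = M₁.card + M₂.card :=
    (Finset.card_filter_add_card_filter_not _).symm
  refine Eq.trans ?_ (percExp_one M₁ r)
  unfold percExp
  rw [sum_powerset_split M P]
  refine Finset.sum_congr rfl fun E₁ hE₁ => ?_
  rw [Finset.mem_powerset] at hE₁
  have hE₁M : E₁ ⊆ monoPairs X := hE₁.trans (Finset.filter_subset _ _)
  have hE₁T : ∀ e ∈ E₁, e.1 ∉ T ∧ e.2 ∉ T := fun e he =>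
    (hP e).1 (Finset.mem_filter.1 (hE₁ he)).2
  set B := crossing X (clus E₁ S) T with hB
  have hBM₂ : B ⊆ M₂ := by
    intro e he
    rw [hB, crossing, Finset.mem_filter] at he
    rw [hM₂, Finset.mem_filter, hP]
    exact ⟨he.1, by tauto⟩
  have hCT : Disjoint (clus E₁ S) T :=
    (clus_union_avoid (X := X) hd hE₁T (E₂ := ∅) (by simp) (by simp)).2.2
  have hBcard : B.card = T.card * (clus E₁ S).card :=
    card_crossing (clus_color hE₁M hS) hT hCT
  have hterm : ∀ E₂ ∈ M₂.powerset,
      ((1 - r) ^ (E₁ ∪ E₂).card * r ^ (M.card - (E₁ ∪ E₂).card)) *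
        (if Disjoint T (clus (E₁ ∪ E₂) S) then
          (r⁻¹) ^ (T.card * (clus (E₁ ∪ E₂) S).card) else 0)
      = if Disjoint E₂ B then ((1 - r) ^ E₁.card * r ^ (M₁.card - E₁.card)) *
          ((1 - r) ^ E₂.card * r ^ ((M₂ \ B).card - E₂.card)) else 0 := by
    intro E₂ hE₂
    rw [Finset.mem_powerset] at hE₂
    have hE₂M : E₂ ⊆ monoPairs X := hE₂.trans (Finset.filter_subset _ _)
    have hE₂T : ∀ e ∈ E₂, ¬ (e.1 ∉ T ∧ e.2 ∉ T) := fun e he =>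
      (hP e).not.1 (Finset.mem_filter.1 (hE₂ he)).2
    obtain ⟨h1, h2, _⟩ := clus_union_avoid hd hE₁T hE₂T hE₂M
    by_cases hdis : Disjoint T (clus (E₁ ∪ E₂) S)
    · have hdisB := h1.1 hdis
      rw [if_pos hdis, if_pos hdisB, h2 hdis, ← hBcard]
      have hdE : Disjoint E₁ E₂ := Finset.disjoint_left.2 fun e he he' => hE₂T e he' (hE₁T e he)
      rw [Finset.card_union_of_disjoint hdE]
      have hc1 := Finset.card_le_card hE₁
      have hc2 : E₂.card ≤ (M₂ \ B).card := Finset.card_le_card fun e he =>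
        Finset.mem_sdiff.2 ⟨hE₂ he, Finset.disjoint_left.1 hdisB he⟩
      have hc3 : (M₂ \ B).card + B.card = M₂.card := Finset.card_sdiff_add_card_eq_card hBM₂
      have hexp : M.card - (E₁.card + E₂.card)
          = (M₁.card - E₁.card) + ((M₂ \ B).card - E₂.card) + B.card := by omega
      rw [hexp, pow_add, pow_add, pow_add, inv_pow]
      have : r ^ B.card ≠ 0 := pow_ne_zero _ hr.ne'
      field_simp
    · rw [if_neg hdis, if_neg (fun h => hdis (h1.2 h)), mul_zero]
  refine (Finset.sum_congr rfl hterm).trans ?_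
  rw [← Finset.sum_filter]
  have hfilter : M₂.powerset.filter (fun E₂ => Disjoint E₂ B) = (M₂ \ B).powerset := by
    ext E₂
    rw [Finset.mem_filter, Finset.mem_powerset, Finset.mem_powerset, Finset.subset_sdiff]
  rw [hfilter, ← Finset.mul_sum, Finset.sum_pow_mul_eq_add_pow]
  simp

theorem percExp_congr {n : ℕ} {M : Finset (Fin n × Fin n)} {r : ℝ}
    {f g : Finset (Fin n × Fin n) → ℝ} (h : ∀ E ∈ M.powerset, f E = g E) :
    percExp M r f = percExp M r g :=
  Finset.sum_congr rfl fun E hE => by rw [h E hE]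

section moments
variable {n q : ℕ} {X : Conf n q} {i : Fin q} {S : Finset (Fin n)} {r : ℝ}

theorem card_clus_le {E : Finset (Fin n × Fin n)} (hE : E ∈ (monoPairs X).powerset)
    (hS : ∀ v ∈ S, X v = i) : (clus E S).card ≤ cntN X i :=
  Finset.card_le_card fun v hv => by
    simpa using clus_color (Finset.mem_powerset.1 hE) hS v hv

theorem percExp_sum_powerset (hS : ∀ v ∈ S, X v = i) (hr : 0 < r) (w : ℕ → ℝ) :
    percExp (monoPairs X) r (fun E => ∑ k ∈ range (cntN X i - (clus E S).card + 1),
      ((cntN X i - (clus E S).card).choose k : ℝ) * (w k * r⁻¹ ^ (k * (clus E S).card)))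
    = ∑ k ∈ range (cntN X i - S.card + 1), ((cntN X i - S.card).choose k : ℝ) * w k := by
  set A := Finset.univ.filter (fun v => X v = i) with hA
  have hAN : A.card = cntN X i := rfl
  have hSA : S ⊆ A := fun v hv => by simp [hA, hS v hv]
  have h1 : ∑ k ∈ range (cntN X i - S.card + 1), ((cntN X i - S.card).choose k : ℝ) * w k
      = ∑ T ∈ (A \ S).powerset, w T.card := by
    rw [Finset.sum_powerset_apply_card, Finset.card_sdiff_of_subset hSA, hAN]
    simp
  have h2 : ∑ T ∈ (A \ S).powerset, w T.card = ∑ T ∈ (A \ S).powerset,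
      percExp (monoPairs X) r (fun E => w T.card * if Disjoint T (clus E S) then
        (r⁻¹) ^ (T.card * (clus E S).card) else 0) := by
    refine Finset.sum_congr rfl fun T hT => ?_
    rw [Finset.mem_powerset] at hT
    have hTA : ∀ v ∈ T, X v = i := fun v hv => by
      have := Finset.mem_sdiff.1 (hT hv)
      simpa [hA] using this.1
    have hST : Disjoint S T :=
      Finset.disjoint_left.2 fun v hv hvT => (Finset.mem_sdiff.1 (hT hvT)).2 hv
    rw [percExp_const_mul, percExp_avoid X hS hTA hST hr, mul_one]
  rw [h1, h2, ← percExp_sum]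
  refine percExp_congr fun E hE => ?_
  have hcA : clus E S ⊆ A := fun v hv => by
    simpa [hA] using clus_color (Finset.mem_powerset.1 hE) hS v hv
  simp only [mul_ite, mul_zero]
  rw [← Finset.sum_filter]
  have hfil : (A \ S).powerset.filter (fun T => Disjoint T (clus E S))
      = (A \ clus E S).powerset := by
    ext T
    rw [Finset.mem_filter, Finset.mem_powerset, Finset.mem_powerset, Finset.subset_sdiff,
      Finset.subset_sdiff]
    constructor
    · rintro ⟨⟨h, _⟩, h'⟩; exact ⟨h, h'⟩
    · rintro ⟨h, h'⟩; exact ⟨⟨h, h'.mono_right subset_clus⟩, h'⟩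
  rw [hfil, Finset.sum_powerset_apply_card (fun k => w k * r⁻¹ ^ (k * (clus E S).card)),
    Finset.card_sdiff_of_subset hcA, hAN]
  simp

theorem percExp_choose (hS : ∀ v ∈ S, X v = i) (hr : 0 < r) (k : ℕ) :
    percExp (monoPairs X) r (fun E => ((cntN X i - (clus E S).card).choose k : ℝ) *
      r⁻¹ ^ (k * (clus E S).card)) = ((cntN X i - S.card).choose k : ℝ) := by
  have h := percExp_sum_powerset hS hr (fun j => if j = k then 1 else 0)
  have key : ∀ (c : ℕ) (g : ℕ → ℝ), ∑ j ∈ range (c + 1),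
      (c.choose j : ℝ) * ((if j = k then 1 else 0) * g j) = (c.choose k : ℝ) * g k := by
    intro c g
    simp only [ite_mul, one_mul, zero_mul, mul_ite, mul_zero, Finset.sum_ite_eq']
    split_ifs with hk
    · rfl
    · rw [Nat.choose_eq_zero_of_lt (by simpa using hk)]; simp
  have key2 := key (cntN X i - S.card) (fun _ => 1)
  simp only [mul_one] at key2
  rw [key2] at h
  rw [← h]
  exact percExp_congr fun E _ => (key (cntN X i - (clus E S).card)
    (fun j => r⁻¹ ^ (j * (clus E S).card))).symm

theorem percExp_pow (hS : ∀ v ∈ S, X v = i) (hr : 0 < r) (z : ℝ) :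
    percExp (monoPairs X) r (fun E => (1 + z * r⁻¹ ^ (clus E S).card) ^
      (cntN X i - (clus E S).card)) = (1 + z) ^ (cntN X i - S.card) := by
  have h := percExp_sum_powerset hS hr (fun k => z ^ k)
  have key : ∀ (c : ℕ) (y : ℝ), (1 + y) ^ c = ∑ k ∈ range (c + 1), (c.choose k : ℝ) * y ^ k := by
    intro c y
    rw [add_comm, add_pow]
    exact Finset.sum_congr rfl fun k _ => by ring
  rw [key, ← h]
  refine percExp_congr fun E _ => ?_
  rw [key]
  refine Finset.sum_congr rfl fun k _ => ?_
  rw [mul_pow, ← pow_mul, mul_comm k]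

theorem card_le_cntN (hS : ∀ v ∈ S, X v = i) : S.card ≤ cntN X i :=
  Finset.card_le_card fun v hv => by simp [hS v hv]

theorem percExp_first (hS : ∀ v ∈ S, X v = i) (hr : 0 < r) :
    percExp (monoPairs X) r (fun E => ((cntN X i : ℝ) - (clus E S).card) *
      r⁻¹ ^ (clus E S).card) = (cntN X i : ℝ) - S.card := by
  have h := percExp_choose hS hr 1
  simp only [Nat.choose_one_right, one_mul] at h
  rw [Nat.cast_sub (card_le_cntN hS)] at h
  rw [← h]
  refine percExp_congr fun E hE => ?_
  rw [Nat.cast_sub (card_clus_le hE hS)]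

theorem percExp_sq_le (hS : ∀ v ∈ S, X v = i) (hr : 0 < r) (hr1 : r ≤ 1) :
    percExp (monoPairs X) r (fun E => (((cntN X i : ℝ) - (clus E S).card) *
      r⁻¹ ^ (clus E S).card - ((cntN X i : ℝ) - S.card)) ^ 2)
      ≤ cntN X i * (r⁻¹ ^ cntN X i) ^ 2 := by
  set N := cntN X i with hN
  have hmN := card_le_cntN hS
  have h1 := percExp_first hS hr
  have h2 := percExp_choose hS hr 2
  have hr1' : 1 ≤ r⁻¹ := (one_le_inv₀ hr).2 hr1
  have hpt : ∀ E ∈ (monoPairs X).powerset, (((N : ℝ) - (clus E S).card) *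
      r⁻¹ ^ (clus E S).card - ((N : ℝ) - S.card)) ^ 2 ≤
      2 * (((N - (clus E S).card).choose 2 : ℝ) * r⁻¹ ^ (2 * (clus E S).card))
        + (-2 * ((N : ℝ) - S.card)) * (((N : ℝ) - (clus E S).card) * r⁻¹ ^ (clus E S).card)
        + (((N : ℝ) - S.card) ^ 2 + N * (r⁻¹ ^ N) ^ 2) := by
    intro E hE
    have hc := card_clus_le hE hS
    rw [Nat.cast_choose_two, Nat.cast_sub hc]
    set c := (clus E S).card
    have hp : r⁻¹ ^ c ≤ r⁻¹ ^ N := pow_le_pow_right₀ hr1' hc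
    have hp0 : 0 ≤ r⁻¹ ^ c := by positivity
    have hsq : (r⁻¹ ^ c) ^ 2 ≤ (r⁻¹ ^ N) ^ 2 := pow_le_pow_left₀ hp0 hp 2
    rw [mul_comm 2 c, pow_mul]
    have hNc : ((N : ℝ) - c) ≤ N := by linarith [(Nat.cast_nonneg c : (0:ℝ) ≤ c)]
    have hNc0 : 0 ≤ ((N : ℝ) - c) := sub_nonneg.2 (by exact_mod_cast hc)
    have : ((N : ℝ) - c) * (r⁻¹ ^ c) ^ 2 ≤ N * (r⁻¹ ^ N) ^ 2 :=
      mul_le_mul hNc hsq (by positivity) (by positivity)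
    nlinarith
  refine (percExp_mono hr.le hr1 hpt).trans ?_
  rw [percExp_add, percExp_add, percExp_const, percExp_const_mul, percExp_const_mul, h1, h2,
    Nat.cast_choose_two, Nat.cast_sub hmN]
  have : (0 : ℝ) ≤ N - S.card := sub_nonneg.2 (by exact_mod_cast hmN)
  nlinarith

end moments

theorem inv_exp_pow {n N : ℕ} {β : ℝ} (hN : 0 < N) (c : ℕ) :
    (Real.exp (-(β / n)))⁻¹ ^ c = Real.exp (β * (N / n) * (c / N)) := by
  rw [← Real.exp_neg, neg_neg, ← Real.exp_nat_mul]
  congr 1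
  have : (N : ℝ) ≠ 0 := by positivity
  field_simp

section supercritical
variable {n q : ℕ} {X : Conf n q} {i : Fin q} {S : Finset (Fin n)} {β L κ s η b : ℝ}

theorem percExp_survival_sq_le (hS : ∀ v ∈ S, X v = i) (hβ : 0 ≤ β) (hN : 0 < cntN X i)
    (hL : β * (cntN X i / n) ≤ L) (hκ0 : 0 ≤ κ)
    (hκ : 2 * κ ≤ (β * (cntN X i / n)) ^ 2 * Real.exp (-(β * (cntN X i / n))))
    (hs0 : 0 < s) (hs1 : s < 1) (hs : Real.exp (-(β * (cntN X i / n)) * s) = 1 - s) :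
    percExp (monoPairs X) (Real.exp (-(β / n))) (fun E =>
      (κ * (clus E S).card * |s - (clus E S).card / cntN X i|) ^ 2)
      ≤ 2 * (cntN X i * Real.exp L ^ 2) + 2 * (S.card : ℝ) ^ 2 := by
  set lam := β * (cntN X i / n) with hlam
  have hlam0 : 0 ≤ lam := by positivity
  have hr : 0 < Real.exp (-(β / n)) := Real.exp_pos _
  have hr1 : Real.exp (-(β / n)) ≤ 1 := Real.exp_le_one_iff.2 (by
    have : 0 ≤ β / n := by positivity
    linarith)
  have hsq := percExp_sq_le hS hr hr1
  set N := cntN X i with hNdef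
  have hN' : (0 : ℝ) < N := by exact_mod_cast hN
  have hB : (Real.exp (-(β / n)))⁻¹ ^ N ≤ Real.exp L := by
    rw [inv_exp_pow hN, div_self hN'.ne', mul_one]
    exact Real.exp_le_exp.2 hL
  have hpt : ∀ E ∈ (monoPairs X).powerset,
      (κ * (clus E S).card * |s - (clus E S).card / N|) ^ 2 ≤
      2 * (((N : ℝ) - (clus E S).card) * (Real.exp (-(β / n)))⁻¹ ^ (clus E S).card
        - ((N : ℝ) - S.card)) ^ 2 + 2 * (S.card : ℝ) ^ 2 := by
    intro E hE
    have hc := card_clus_le hE hS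
    rw [inv_exp_pow hN]
    set c := (clus E S).card
    have hc' : (c : ℝ) ≤ N := by exact_mod_cast hc
    set y := (c : ℝ) / N with hy
    have hy0 : 0 ≤ y := div_nonneg (Nat.cast_nonneg _) hN'.le
    have hy1 : y ≤ 1 := (div_le_one hN').2 hc'
    have hcy : (c : ℝ) = N * y := by rw [hy, mul_comm, div_mul_cancel₀ _ hN'.ne']
    have h1 := survival_defect_abs hκ hlam0 hs0 hs1 hs hy0 hy1
    have hW : ((N : ℝ) - c) * Real.exp (lam * y) - N
        = N * (Real.exp (lam * y) * (1 - y - Real.exp (-lam * y))) := by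
      have : Real.exp (lam * y) * Real.exp (-lam * y) = 1 := by rw [← Real.exp_add, neg_mul, add_neg_cancel, Real.exp_zero]
      rw [hcy]
      linear_combination (N : ℝ) * this
    have h2 : κ * c * |s - y| ≤ |((N : ℝ) - c) * Real.exp (lam * y) - N| := by
      rw [hW, abs_mul, abs_mul, abs_of_pos hN', abs_of_pos (Real.exp_pos _), hcy]
      have h3 : 1 ≤ Real.exp (lam * y) := Real.one_le_exp (mul_nonneg hlam0 hy0)
      have h4 := abs_nonneg (1 - y - Real.exp (-lam * y))
      have h5 : |1 - y - Real.exp (-lam * y)|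
          ≤ Real.exp (lam * y) * |1 - y - Real.exp (-lam * y)| := by nlinarith
      calc κ * (N * y) * |s - y| = N * (κ * y * |s - y|) := by ring
        _ ≤ _ := mul_le_mul_of_nonneg_left (h1.trans h5) hN'.le
    have h6 : (κ * c * |s - y|) ^ 2 ≤ (((N : ℝ) - c) * Real.exp (lam * y) - N) ^ 2 := by
      rw [← sq_abs (((N : ℝ) - c) * Real.exp (lam * y) - N)]
      exact pow_le_pow_left₀ (mul_nonneg (mul_nonneg hκ0 (Nat.cast_nonneg _)) (abs_nonneg _)) h2 2
    refine h6.trans ?_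
    nlinarith [sq_nonneg (((N : ℝ) - c) * Real.exp (lam * y) - (N - S.card) + S.card)]
  refine (percExp_mono hr.le hr1 hpt).trans ?_
  rw [percExp_add, percExp_const_mul, percExp_const]
  have : (N : ℝ) * ((Real.exp (-(β / n)))⁻¹ ^ N) ^ 2 ≤ N * Real.exp L ^ 2 :=
    mul_le_mul_of_nonneg_left (pow_le_pow_left₀ (by positivity) hB 2) hN'.le
  linarith

set_option maxHeartbeats 800000 in
theorem log_gen_lower {lam y : ℝ} (hlam : 0 ≤ lam) (hL : lam ≤ L) (hκ0 : 0 < κ)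
    (hκ : 2 * κ ≤ lam ^ 2 * Real.exp (-lam))
    (hs0 : 0 < s) (hs1 : s < 1) (hs : Real.exp (-lam * s) = 1 - s) {s₁ : ℝ} (hs₁ : s₁ ≤ s)
    (hη0 : 0 < η) (hη : η * ((1 + Real.exp L) * Real.exp L) ≤ κ * s₁ / 6)
    (hy0 : 0 ≤ y) (hy : y ≤ 2 / 3 * s) :
    η * (κ * s₁ / 6) * y ≤ (1 - y) * Real.log (1 + η * Real.exp (lam * y)) - Real.log (1 + η) := by
  have hy1 : y < 1 := by linarith
  have hG := (survival_defect hκ hlam hs0 hs1 hs).1 y hy0 (by linarith)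
  have hG' : κ * s₁ / 3 * y ≤ 1 - y - Real.exp (-lam * y) := by
    refine le_trans ?_ hG
    have : s₁ / 3 ≤ s - y := by linarith
    have := mul_le_mul_of_nonneg_left this (mul_nonneg hκ0.le hy0)
    linarith
  have hE1 : 1 ≤ Real.exp (lam * y) := Real.one_le_exp (mul_nonneg hlam hy0)
  have hEE : Real.exp (lam * y) * Real.exp (-lam * y) = 1 := by rw [← Real.exp_add, neg_mul, add_neg_cancel, Real.exp_zero]
  have hGnn : 0 ≤ 1 - y - Real.exp (-lam * y) := by
    refine le_trans ?_ hG
    exact mul_nonneg (mul_nonneg hκ0.le hy0) (by linarith)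
  set u := Real.exp (lam * y) - 1 with hu
  have hu0 : 0 ≤ u := by linarith
  set B := Real.exp L with hB
  have hB0 : 0 < B := Real.exp_pos _
  have hlamB : Real.exp lam ≤ B := Real.exp_le_exp.2 hL
  have huy : u ≤ B * y := by
    have h := convexOn_exp.2 (Set.mem_univ (0:ℝ)) (Set.mem_univ lam) (sub_nonneg.2 hy1.le) hy0
      (by ring)
    simp only [smul_eq_mul, mul_zero, zero_add, Real.exp_zero, mul_one] at h
    rw [mul_comm y lam] at h
    nlinarith
  have huB : u ≤ B := by nlinarith
  have hψ : κ * s₁ / 3 * y ≤ (1 - y) * u - y := by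
    have : (1 - y) * u - y = Real.exp (lam * y) * (1 - y - Real.exp (-lam * y)) := by
      rw [hu]; linear_combination hEE
    rw [this]
    nlinarith
  set t := η / (1 + η) * u with ht
  have hη' : η * (1 - η) ≤ η / (1 + η) := by
    rw [le_div_iff₀ (by linarith)]
    nlinarith [pow_pos hη0 3]
  have hη'' : η / (1 + η) ≤ η := by
    rw [div_le_iff₀ (by linarith)]; nlinarith
  have ht0 : 0 ≤ t := by positivity
  have hfac : 1 + η * Real.exp (lam * y) = (1 + η) * (1 + t) := by
    rw [ht, hu]; field_simp; ring
  rw [hfac, Real.log_mul (by linarith) (by linarith)]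
  have hlog1 : Real.log (1 + η) ≤ η := by
    have := Real.log_le_sub_one_of_pos (by linarith : 0 < 1 + η)
    linarith
  have hlog2 : t * (1 - t) ≤ Real.log (1 + t) := by
    have h := Real.one_sub_inv_le_log_of_pos (by linarith : 0 < 1 + t)
    refine le_trans ?_ h
    have : 1 - (1 + t)⁻¹ = t / (1 + t) := by field_simp; ring
    rw [this, le_div_iff₀ (by linarith)]
    nlinarith [pow_nonneg ht0 3]
  have ht1 : t ≤ η * B := mul_le_mul hη'' huB hu0 hη0.le
  have hlow : η * u - η * u * (η * (1 + B)) ≤ Real.log (1 + t) := by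
    refine le_trans ?_ hlog2
    have h1 : t * (1 - η * B) ≤ t * (1 - t) := mul_le_mul_of_nonneg_left (by linarith) ht0
    refine le_trans ?_ h1
    have h2 : η * (1 - η) * u ≤ t := mul_le_mul_of_nonneg_right hη' hu0
    have h3 : t ≤ η * u := mul_le_mul_of_nonneg_right hη'' hu0
    have h4 : t * (η * B) ≤ η * u * (η * B) := mul_le_mul_of_nonneg_right h3 (by positivity)
    calc η * u - η * u * (η * (1 + B)) = η * (1 - η) * u - η * u * (η * B) := by ring
      _ ≤ t - t * (η * B) := sub_le_sub h2 h4
      _ = t * (1 - η * B) := by ring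
  clear_value t
  clear_value u
  clear_value B
  have h1y : 0 ≤ 1 - y := by linarith
  have h5 := mul_le_mul_of_nonneg_left hlow h1y
  have h6 : (1 - y) * (η * u * (η * (1 + B))) ≤ η * (η * ((1 + B) * B)) * y := by
    have h7 : (1 - y) * u ≤ B * y := by nlinarith
    have h8 := mul_le_mul_of_nonneg_left h7 (by positivity : 0 ≤ η * (η * (1 + B)))
    nlinarith
  have h9 : η * (η * ((1 + B) * B)) * y ≤ η * (κ * s₁ / 6) * y := by gcongr
  have h10 := mul_le_mul_of_nonneg_left hψ hη0.le
  have h11 : y * Real.log (1 + η) ≤ y * η := mul_le_mul_of_nonneg_left hlog1 hy0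
  nlinarith

theorem percExp_small_exp_le (hS : ∀ v ∈ S, X v = i) (hβ : 0 ≤ β) (hN : 0 < cntN X i)
    (hL : β * (cntN X i / n) ≤ L) (hκ0 : 0 < κ)
    (hκ : 2 * κ ≤ (β * (cntN X i / n)) ^ 2 * Real.exp (-(β * (cntN X i / n))))
    (hs0 : 0 < s) (hs1 : s < 1) (hs : Real.exp (-(β * (cntN X i / n)) * s) = 1 - s)
    {s₁ : ℝ} (hs₁ : s₁ ≤ s)
    (hη0 : 0 < η) (hη : η * ((1 + Real.exp L) * Real.exp L) ≤ κ * s₁ / 6) :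
    percExp (monoPairs X) (Real.exp (-(β / n))) (fun E =>
      if ((clus E S).card : ℝ) ≤ 2 / 3 * s * cntN X i then
        Real.exp (η * (κ * s₁ / 6) * (clus E S).card) else 0)
      ≤ ((1 + η) ^ S.card)⁻¹ := by
  set lam := β * (cntN X i / n) with hlam
  have hlam0 : 0 ≤ lam := by positivity
  have hr : 0 < Real.exp (-(β / n)) := Real.exp_pos _
  have hr1 : Real.exp (-(β / n)) ≤ 1 := Real.exp_le_one_iff.2 (by
    have : 0 ≤ β / n := by positivity
    linarith)
  have hpow := percExp_pow hS hr η
  have hmN := card_le_cntN hS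
  set N := cntN X i with hNdef
  have hN' : (0 : ℝ) < N := by exact_mod_cast hN
  have h1η : 0 < 1 + η := by linarith
  have hpt : ∀ E ∈ (monoPairs X).powerset,
      (if ((clus E S).card : ℝ) ≤ 2 / 3 * s * N then
        Real.exp (η * (κ * s₁ / 6) * (clus E S).card) else 0)
      ≤ ((1 + η) ^ N)⁻¹ * (1 + η * (Real.exp (-(β / n)))⁻¹ ^ (clus E S).card) ^
        (N - (clus E S).card) := by
    intro E hE
    have hc := card_clus_le hE hS
    split_ifs with hsmall
    · rw [inv_exp_pow hN]
      set c := (clus E S).card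
      set y := (c : ℝ) / N with hy
      have hcy : (c : ℝ) = N * y := by rw [hy, mul_comm, div_mul_cancel₀ _ hN'.ne']
      have hy0 : 0 ≤ y := div_nonneg (Nat.cast_nonneg _) hN'.le
      have hy2 : y ≤ 2 / 3 * s := by rw [hy, div_le_iff₀ hN']; exact hsmall
      have h := log_gen_lower hlam0 hL hκ0 hκ hs0 hs1 hs hs₁ hη0 hη hy0 hy2
      have hpos : 0 < 1 + η * Real.exp (lam * y) := by positivity
      have e1 : (1 + η * Real.exp (lam * y)) ^ (N - c)
          = Real.exp (((N - c : ℕ) : ℝ) * Real.log (1 + η * Real.exp (lam * y))) := by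
        rw [Real.exp_nat_mul, Real.exp_log hpos]
      have e2 : (1 + η) ^ N = Real.exp ((N : ℝ) * Real.log (1 + η)) := by
        rw [Real.exp_nat_mul, Real.exp_log h1η]
      rw [e1, e2, ← Real.exp_neg, ← Real.exp_add]
      apply Real.exp_le_exp.2
      rw [Nat.cast_sub hc, hcy]
      have h2 := mul_le_mul_of_nonneg_left h hN'.le
      linarith
    · positivity
  refine (percExp_mono hr.le hr1 hpt).trans (le_of_eq ?_)
  rw [percExp_const_mul, hpow]
  have : (1 + η) ^ N = (1 + η) ^ (N - S.card) * (1 + η) ^ S.card := by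
    rw [← pow_add, Nat.sub_add_cancel hmN]
  rw [this]
  field_simp

theorem percExp_card_clus_le_of_subcritical {v : Fin n} (hv : X v = i) (hβ : 0 ≤ β)
    {r₀ : ℝ} (hr₀ : r₀ < 1) (hr₀' : 0 ≤ r₀) (hsub : β * (cntN X i / n) ≤ r₀) :
    percExp (monoPairs X) (Real.exp (-(β / n))) (fun E => ((clus E {v}).card : ℝ))
      ≤ 2 / (1 - r₀) := by
  have hS : ∀ w ∈ ({v} : Finset (Fin n)), X w = i := by simp [hv]
  have hr : 0 < Real.exp (-(β / n)) := Real.exp_pos _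
  have hr1 : Real.exp (-(β / n)) ≤ 1 := Real.exp_le_one_iff.2 (by
    have : 0 ≤ β / n := by positivity
    linarith)
  have hN : 0 < cntN X i := lt_of_lt_of_le (by simp) (card_le_cntN hS)
  have h1 := percExp_first hS hr
  set N := cntN X i with hNdef
  have hN' : (0 : ℝ) < N := by exact_mod_cast hN
  have hpt : ∀ E ∈ (monoPairs X).powerset, ((N : ℝ) - (clus E {v}).card) *
      (Real.exp (-(β / n)))⁻¹ ^ (clus E {v}).card
      ≤ N + (-((1 - r₀) / 2)) * ((clus E {v}).card : ℝ) := by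
    intro E hE
    have hc := card_clus_le hE hS
    rw [inv_exp_pow hN]
    set c := (clus E {v}).card
    have hc' : (c : ℝ) ≤ N := by exact_mod_cast hc
    set y := (c : ℝ) / N with hy
    have hcy : (c : ℝ) = N * y := by rw [hy, mul_comm, div_mul_cancel₀ _ hN'.ne']
    have hy0 : 0 ≤ y := div_nonneg (Nat.cast_nonneg _) hN'.le
    have hy1 : y ≤ 1 := (div_le_one hN').2 hc'
    set t := (1 - r₀) * y with ht
    have ht0 : 0 ≤ t := mul_nonneg (by linarith) hy0
    have ht1 : t ≤ 1 := by nlinarith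
    have h2 : (1 - y) * Real.exp (β * (N / n) * y) ≤ Real.exp (-t) := by
      have h3 : 1 - y ≤ Real.exp (-y) := Real.one_sub_le_exp_neg y
      have h4 : Real.exp (β * (N / n) * y) ≤ Real.exp (r₀ * y) :=
        Real.exp_le_exp.2 (mul_le_mul_of_nonneg_right hsub hy0)
      calc (1 - y) * Real.exp (β * (N / n) * y) ≤ Real.exp (-y) * Real.exp (r₀ * y) :=
            mul_le_mul h3 h4 (Real.exp_pos _).le (Real.exp_pos _).le
        _ = Real.exp (-t) := by rw [← Real.exp_add, ht]; congr 1; ring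
    have h5 : Real.exp (-t) ≤ 1 - t / 2 := by
      have h6 : 1 + t ≤ Real.exp t := by linarith [Real.add_one_le_exp t]
      have h7 : Real.exp t * Real.exp (-t) = 1 := by rw [← Real.exp_add, add_neg_cancel, Real.exp_zero]
      have h8 := Real.exp_pos (-t)
      have h9 : (1 + t) * Real.exp (-t) ≤ 1 := by nlinarith
      by_contra hcon
      push Not at hcon
      nlinarith
    have h10 := mul_le_mul_of_nonneg_left (h2.trans h5) hN'.le
    rw [hcy]
    nlinarith
  have h2 := percExp_mono hr.le hr1 hpt
  rw [h1, percExp_add, percExp_const, percExp_const_mul, Finset.card_singleton] at h2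
  rw [le_div_iff₀ (by linarith)]
  push_cast at h2
  linarith

end supercritical

/-- Average of `φ` over the colorings that are constant on the components of `(V, E)`. -/
noncomputable def colAvg {n q : ℕ} (E : Finset (Fin n × Fin n)) (φ : Conf n q → ℝ) : ℝ :=
  ∑ τ : Conf n q, (if ∀ u v : Fin n, (graphOf E).Reachable u v → τ u = τ v then
    ((q : ℝ))⁻¹ ^ numComps E else 0) * φ τ

section coloring
variable {n q : ℕ} {E : Finset (Fin n × Fin n)}

theorem sum_swStep_mul (β : ℝ) (X : Conf n q) (φ : Conf n q → ℝ) :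
    ∑ τ, swStep n q β X τ * φ τ
      = percExp (monoPairs X) (Real.exp (-(β / n))) (fun E => colAvg E φ) := by
  unfold swStep percExp colAvg
  simp only [Finset.sum_mul, Finset.mul_sum]
  rw [Finset.sum_comm]
  exact Finset.sum_congr rfl fun E _ => Finset.sum_congr rfl fun τ _ => by ring

theorem colAvg_mono {φ ψ : Conf n q → ℝ}
    (h : ∀ τ, (∀ u v : Fin n, (graphOf E).Reachable u v → τ u = τ v) → φ τ ≤ ψ τ) :
    colAvg E φ ≤ colAvg E ψ := by
  refine Finset.sum_le_sum fun τ _ => ?_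
  split_ifs with hτ
  · exact mul_le_mul_of_nonneg_left (h τ hτ) (by positivity)
  · simp

theorem colAvg_add (φ ψ : Conf n q → ℝ) :
    colAvg E (fun τ => φ τ + ψ τ) = colAvg E φ + colAvg E ψ := by
  unfold colAvg
  rw [← Finset.sum_add_distrib]
  exact Finset.sum_congr rfl fun τ _ => by ring

theorem colAvg_const_mul (c : ℝ) (φ : Conf n q → ℝ) :
    colAvg E (fun τ => c * φ τ) = c * colAvg E φ := by
  unfold colAvg
  rw [Finset.mul_sum]
  exact Finset.sum_congr rfl fun τ _ => by ring

theorem colAvg_sum {ι : Type*} (s : Finset ι) (φ : ι → Conf n q → ℝ) :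
    colAvg E (fun τ => ∑ i ∈ s, φ i τ) = ∑ i ∈ s, colAvg E (φ i) := by
  unfold colAvg
  rw [Finset.sum_comm]
  exact Finset.sum_congr rfl fun τ _ => by rw [Finset.mul_sum]

theorem colAvg_eq_sum_comp (φ : Conf n q → ℝ) :
    colAvg E φ = ((q : ℝ))⁻¹ ^ numComps E *
      ∑ c : (graphOf E).ConnectedComponent → Fin q,
        φ (fun v => c ((graphOf E).connectedComponentMk v)) := by
  unfold colAvg
  simp only [ite_mul, zero_mul]
  rw [← Finset.sum_filter, ← Finset.mul_sum]
  congr 1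
  symm
  refine Finset.sum_bij (fun c _ v => c ((graphOf E).connectedComponentMk v)) ?_ ?_ ?_ ?_
  · intro c _
    rw [Finset.mem_filter]
    refine ⟨Finset.mem_univ _, fun u v huv => ?_⟩
    exact congrArg c (SimpleGraph.ConnectedComponent.sound huv)
  · intro c _ d _ h
    funext k
    induction k using SimpleGraph.ConnectedComponent.ind with
    | _ v => exact congrFun h v
  · intro τ hτ
    rw [Finset.mem_filter] at hτ
    exact ⟨fun k => k.lift τ fun u v p _ => hτ.2 u v p.reachable, Finset.mem_univ _, rfl⟩
  · intro c _
    rfl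

theorem colAvg_const (hq : 0 < q) (a : ℝ) : colAvg E (fun _ : Conf n q => a) = a := by
  rw [colAvg_eq_sum_comp, Finset.sum_const, Finset.card_univ, Fintype.card_fun, Fintype.card_fin,
    numComps, Nat.card_eq_fintype_card, nsmul_eq_mul, Nat.cast_pow, ← mul_assoc, ← mul_pow,
    inv_mul_cancel₀ (by positivity), one_pow, one_mul]

theorem colAvg_centered_mul (hq : 0 < q) (j : Fin q) {u v : Fin n}
    (huv : ¬ (graphOf E).Reachable u v) :
    colAvg E (fun τ : Conf n q => ((if τ u = j then 1 else 0) - (q : ℝ)⁻¹) *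
      ((if τ v = j then 1 else 0) - (q : ℝ)⁻¹)) = 0 := by
  rw [colAvg_eq_sum_comp]
  refine mul_eq_zero_of_right _ ?_
  set k := (graphOf E).connectedComponentMk u
  set l := (graphOf E).connectedComponentMk v
  have hkl : l ≠ k := fun h => huv (SimpleGraph.ConnectedComponent.exact h.symm)
  rw [← (Equiv.funSplitAt k (Fin q)).symm.sum_comp, Fintype.sum_prod_type, Finset.sum_comm]
  refine Finset.sum_eq_zero fun f _ => ?_
  have hk : ∀ x : Fin q, (Equiv.funSplitAt k (Fin q)).symm (x, f) k = x := fun x => by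
    simp [Equiv.funSplitAt, Equiv.piSplitAt]
  have hl : ∀ x : Fin q, (Equiv.funSplitAt k (Fin q)).symm (x, f) l = f ⟨l, hkl⟩ := fun x => by
    simp [Equiv.funSplitAt, Equiv.piSplitAt, hkl]
  calc _ = ∑ x : Fin q, ((if x = j then 1 else 0) - (q : ℝ)⁻¹) *
        ((if f ⟨l, hkl⟩ = j then 1 else 0) - (q : ℝ)⁻¹) :=
        Finset.sum_congr rfl fun x _ => congrArg₂ (fun a b : Fin q =>
          ((if a = j then (1 : ℝ) else 0) - (q : ℝ)⁻¹) * ((if b = j then 1 else 0) - (q : ℝ)⁻¹))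
          (hk x) (hl x)
    _ = 0 := ?_
  rw [← Finset.sum_mul]
  refine mul_eq_zero_of_left ?_ _
  rw [Finset.sum_sub_distrib]
  have : (q : ℝ) ≠ 0 := by positivity
  simp [this]

theorem colAvg_sq_count_le (hq : 0 < q) (j : Fin q) (A : Finset (Fin n)) :
    colAvg E (fun τ : Conf n q => (((A.filter (fun v => τ v = j)).card : ℝ) - A.card / q) ^ 2)
      ≤ ∑ v ∈ A, ((clus E {v}).card : ℝ) := by
  have hq1 : (1 : ℝ) ≤ q := by exact_mod_cast hq
  have hqi : (q : ℝ)⁻¹ ≤ 1 := inv_le_one_of_one_le₀ hq1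
  have hqi0 : 0 ≤ (q : ℝ)⁻¹ := by positivity
  have hexp : ∀ τ : Conf n q, (((A.filter (fun v => τ v = j)).card : ℝ) - A.card / q) ^ 2
      = ∑ u ∈ A, ∑ v ∈ A, ((if τ u = j then 1 else 0) - (q : ℝ)⁻¹) *
        ((if τ v = j then 1 else 0) - (q : ℝ)⁻¹) := by
    intro τ
    rw [← Finset.sum_mul_sum, ← sq, Finset.sum_sub_distrib, Finset.sum_const, nsmul_eq_mul,
      Finset.card_filter, div_eq_mul_inv]
    push_cast
    rfl
  simp only [hexp]
  rw [colAvg_sum]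
  refine Finset.sum_le_sum fun u _ => ?_
  rw [colAvg_sum]
  have hle : ∀ v ∈ A, colAvg E (fun τ : Conf n q => ((if τ u = j then 1 else 0) - (q : ℝ)⁻¹) *
      ((if τ v = j then 1 else 0) - (q : ℝ)⁻¹)) ≤ if v ∈ clus E {u} then 1 else 0 := by
    intro v _
    have hmem : v ∈ clus E {u} ↔ (graphOf E).Reachable u v := by simp [mem_clus]
    split_ifs with h
    · refine (colAvg_mono (ψ := fun _ => 1) fun τ _ => ?_).trans (colAvg_const hq 1).le
      have hb : ∀ w : Fin n, |(if τ w = j then (1 : ℝ) else 0) - (q : ℝ)⁻¹| ≤ 1 := by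
        intro w
        rw [abs_le]
        split_ifs <;> constructor <;> linarith
      refine (le_abs_self _).trans ?_
      rw [abs_mul]
      exact mul_le_one₀ (hb u) (abs_nonneg _) (hb v)
    · exact (colAvg_centered_mul hq j (hmem.not.1 h)).le
  refine (Finset.sum_le_sum hle).trans ?_
  rw [← Finset.sum_filter, Finset.sum_const, nsmul_eq_mul, mul_one]
  exact_mod_cast Finset.card_le_card fun v hv => (Finset.mem_filter.1 hv).2

theorem sum_swStep (hq : 0 < q) (β : ℝ) (X : Conf n q) : ∑ τ, swStep n q β X τ = 1 := by
  have h := sum_swStep_mul β X (fun _ => 1)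
  simp only [mul_one, colAvg_const hq] at h
  rw [h, percExp_one]

theorem swStep_nonneg {β : ℝ} (hβ : 0 ≤ β) (X τ : Conf n q) : 0 ≤ swStep n q β X τ := by
  have hr1 : Real.exp (-(β / n)) ≤ 1 := Real.exp_le_one_iff.2 (by
    have : 0 ≤ β / n := by positivity
    linarith)
  refine Finset.sum_nonneg fun E _ => mul_nonneg (mul_nonneg (pow_nonneg (by linarith) _)
    (by positivity)) ?_
  split_ifs <;> positivity

theorem swProb_nonneg {β : ℝ} (hβ : 0 ≤ β) (t : ℕ) (X τ : Conf n q) : 0 ≤ swProb n q β t X τ := by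
  induction t generalizing X with
  | zero => unfold swProb; split_ifs <;> norm_num
  | succ t ih => exact Finset.sum_nonneg fun η _ => mul_nonneg (swStep_nonneg hβ _ _) (ih η)

theorem sum_swProb (hq : 0 < q) (β : ℝ) (t : ℕ) (X : Conf n q) :
    ∑ τ, swProb n q β t X τ = 1 := by
  induction t generalizing X with
  | zero => simp [swProb]
  | succ t ih =>
    simp only [swProb]
    rw [Finset.sum_comm]
    simp only [← Finset.mul_sum, ih, mul_one]
    exact sum_swStep hq β X

end coloring

section supnorm
variable {q : ℕ}

theorem abs_sub_le_linf (f g : Fin q → ℝ) (i : Fin q) : |f i - g i| ≤ linf f g :=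
  le_ciSup (f := fun i => |f i - g i|) (Set.finite_range _).bddAbove i

theorem linf_le (hq : 0 < q) {f g : Fin q → ℝ} {s : ℝ} (h : ∀ i, |f i - g i| ≤ s) :
    linf f g ≤ s :=
  haveI : Nonempty (Fin q) := ⟨⟨0, hq⟩⟩
  ciSup_le h

theorem linf_nonneg (f g : Fin q → ℝ) : 0 ≤ linf f g :=
  Real.iSup_nonneg fun _ => abs_nonneg _

theorem linf_triangle (hq : 0 < q) (f g h : Fin q → ℝ) : linf f h ≤ linf f g + linf g h :=
  linf_le hq fun i => (abs_sub_le _ (g i) _).trans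
    (add_le_add (abs_sub_le_linf f g i) (abs_sub_le_linf g h i))

theorem linf_kappaVec_le (hq : 2 ≤ q) (b c : ℝ) :
    linf (kappaVec q b) (kappaVec q c) ≤ |b - c| := by
  refine linf_le (by omega) fun i => ?_
  unfold kappaVec
  split_ifs
  · exact le_rfl
  · have h1 : (1 : ℝ) ≤ q - 1 := by
      have : (2 : ℝ) ≤ q := by exact_mod_cast hq
      linarith
    rw [← sub_div, abs_div, abs_of_pos (by linarith : (0 : ℝ) < q - 1),
      show (1 - b - (1 - c)) = -(b - c) by ring, abs_neg]
    exact div_le_self (abs_nonneg _) h1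

end supnorm

section sorting
variable {n q : ℕ}

theorem cntFrac_nonneg (X : Conf n q) (j : Fin q) : 0 ≤ cntFrac X j := by
  unfold cntFrac; positivity

theorem cntFrac_le_one (X : Conf n q) (j : Fin q) : cntFrac X j ≤ 1 := by
  refine div_le_one_of_le₀ ?_ (Nat.cast_nonneg _)
  exact_mod_cast (Finset.card_le_univ _).trans (Fintype.card_fin n).le

theorem cntFrac_le_alphaVec_zero (hq : 0 < q) (X : Conf n q) (j : Fin q) :
    cntFrac X j ≤ alphaVec X ⟨0, hq⟩ := by
  have h := Tuple.monotone_sort (cntFrac X)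
    (show (Tuple.sort (cntFrac X)).symm j ≤ (⟨0, hq⟩ : Fin q).rev by
      rw [Fin.le_def, Fin.val_rev]
      have := ((Tuple.sort (cntFrac X)).symm j).isLt
      simp only
      omega)
  simpa [alphaVec] using h

theorem linf_alphaVec_le_one (hq : 2 ≤ q) (X : Conf n q) {b : ℝ} (hb0 : 0 ≤ b) (hb1 : b ≤ 1) :
    linf (alphaVec X) (kappaVec q b) ≤ 1 := by
  refine linf_le (by omega) fun i => ?_
  have h0 := cntFrac_nonneg X (Tuple.sort (cntFrac X) i.rev)
  have h1 := cntFrac_le_one X (Tuple.sort (cntFrac X) i.rev)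
  have hk : 0 ≤ kappaVec q b i ∧ kappaVec q b i ≤ 1 := by
    unfold kappaVec
    have hq' : (1 : ℝ) ≤ q - 1 := by
      have : (2 : ℝ) ≤ q := by exact_mod_cast hq
      linarith
    split_ifs
    · exact ⟨hb0, hb1⟩
    · exact ⟨div_nonneg (by linarith) (by linarith),
        div_le_one_of_le₀ (by linarith) (by linarith)⟩
  unfold alphaVec
  rw [abs_le]
  constructor <;> linarith [hk.1, hk.2]

theorem linf_alphaVec_kappaVec_le (hq : 2 ≤ q) (X : Conf n q) (j₀ : Fin q) {b s : ℝ}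
    (h₀ : |cntFrac X j₀ - b| ≤ s) (h : ∀ j, j ≠ j₀ → |cntFrac X j - (1 - b) / ((q : ℝ) - 1)| ≤ s)
    (hb : (1 - b) / ((q : ℝ) - 1) ≤ b) :
    linf (alphaVec X) (kappaVec q b) ≤ s := by
  have hq0 : 0 < q := by omega
  refine linf_le hq0 fun i => ?_
  rw [abs_le] at h₀
  have hmax := cntFrac_le_alphaVec_zero hq0 X j₀
  by_cases hi : i = ⟨0, hq0⟩
  · subst hi
    have hk : kappaVec q b ⟨0, hq0⟩ = b := by simp [kappaVec]
    rw [hk, abs_le]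
    refine ⟨by linarith, ?_⟩
    by_cases hj : Tuple.sort (cntFrac X) (⟨0, hq0⟩ : Fin q).rev = j₀
    · have : alphaVec X ⟨0, hq0⟩ = cntFrac X j₀ := by rw [← hj]; rfl
      linarith
    · have := (abs_le.1 (h _ hj)).2
      unfold alphaVec
      linarith
  · have hi' : (i : ℕ) ≠ 0 := fun h => hi (Fin.ext h)
    have hk : kappaVec q b i = (1 - b) / ((q : ℝ) - 1) := by simp [kappaVec, hi']
    rw [hk]
    by_cases hj : Tuple.sort (cntFrac X) i.rev = j₀
    · have hne : Tuple.sort (cntFrac X) (⟨0, hq0⟩ : Fin q).rev ≠ j₀ := by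
        intro h2
        exact hi (Fin.rev_injective ((Tuple.sort (cntFrac X)).injective (hj.trans h2.symm)))
      have h3 := (abs_le.1 (h _ hne)).2
      have h4 : alphaVec X i = cntFrac X j₀ := by rw [← hj]; rfl
      rw [h4, abs_le]
      unfold alphaVec at hmax
      constructor <;> linarith
    · exact h _ hj

theorem exists_dominant_spin (hq : 2 ≤ q) (X : Conf n q) {b ε : ℝ}
    (h : linf (alphaVec X) (kappaVec q b) ≤ ε) :
    ∃ i₀ : Fin q, |cntFrac X i₀ - b| ≤ ε ∧
      ∀ j, j ≠ i₀ → cntFrac X j ≤ (1 - b) / ((q : ℝ) - 1) + ε := by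
  have hq0 : 0 < q := by omega
  refine ⟨Tuple.sort (cntFrac X) (⟨0, hq0⟩ : Fin q).rev, ?_, ?_⟩
  · have := (abs_sub_le_linf (alphaVec X) (kappaVec q b) ⟨0, hq0⟩).trans h
    simpa [kappaVec, alphaVec] using this
  · intro j hj
    set i := ((Tuple.sort (cntFrac X)).symm j).rev with hi
    have hi0 : (i : ℕ) ≠ 0 := by
      intro h0
      apply hj
      have : i = ⟨0, hq0⟩ := Fin.ext h0
      rw [← this, hi, Fin.rev_rev, Equiv.apply_symm_apply]
    have h1 := (abs_sub_le_linf (alphaVec X) (kappaVec q b) i).trans h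
    have h2 : alphaVec X i = cntFrac X j := by
      unfold alphaVec
      rw [hi, Fin.rev_rev, Equiv.apply_symm_apply]
    have h3 : kappaVec q b i = (1 - b) / ((q : ℝ) - 1) := by simp [kappaVec, hi0]
    rw [h2, h3] at h1
    linarith [(abs_le.1 h1).2]

end sorting

/-- The class of spin `i` is supercritical, with survival probability `s ≥ s₁`, while all the
other classes are subcritical. -/
structure OneSupercritical {n q : ℕ} (X : Conf n q) (i : Fin q) (β κ s s₁ η r₀ : ℝ) : Prop where
  beta_nonneg : 0 ≤ β
  card_pos : 0 < cntN X i
  kappa_pos : 0 < κ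
  kappa_le : 2 * κ ≤ (β * (cntN X i / n)) ^ 2 * Real.exp (-(β * (cntN X i / n)))
  s_pos : 0 < s
  s_lt_one : s < 1
  s_eq : Real.exp (-(β * (cntN X i / n)) * s) = 1 - s
  s₁_pos : 0 < s₁
  s₁_le : s₁ ≤ s
  eta_pos : 0 < η
  eta_le : η * ((1 + Real.exp β) * Real.exp β) ≤ κ * s₁ / 6
  r₀_nonneg : 0 ≤ r₀
  r₀_lt_one : r₀ < 1
  subcritical : ∀ j, j ≠ i → β * (cntN X j / n) ≤ r₀

theorem clus_singleton_congr {n : ℕ} {E : Finset (Fin n × Fin n)} {u v : Fin n}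
    (h : (graphOf E).Reachable u v) : clus E {u} = clus E {v} := by
  ext w
  simp only [mem_clus, Finset.mem_singleton, exists_eq_left]
  exact ⟨fun h' => h.symm.trans h', fun h' => h.trans h'⟩

theorem clus_subset_clus {n : ℕ} {E : Finset (Fin n × Fin n)} {S T : Finset (Fin n)}
    (h : S ⊆ T) : clus E S ⊆ clus E T := fun w hw => by
  obtain ⟨v, hv, hvw⟩ := mem_clus.1 hw
  exact mem_clus.2 ⟨v, h hv, hvw⟩

theorem mem_clus_singleton {n : ℕ} {E : Finset (Fin n × Fin n)} {u v : Fin n} :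
    v ∈ clus E {u} ↔ (graphOf E).Reachable u v := by
  simp only [mem_clus, Finset.mem_singleton, exists_eq_left]

namespace OneSupercritical
variable {n q : ℕ} {X : Conf n q} {i : Fin q} {β κ s s₁ η r₀ : ℝ}

theorem exp_nonneg' (H : OneSupercritical X i β κ s s₁ η r₀) :
    0 ≤ Real.exp (-(β / n)) ∧ Real.exp (-(β / n)) ≤ 1 :=
  ⟨(Real.exp_pos _).le, Real.exp_le_one_iff.2 (by
    have := div_nonneg H.beta_nonneg (Nat.cast_nonneg (α := ℝ) n)
    linarith)⟩

theorem mean_degree_le (H : OneSupercritical X i β κ s s₁ η r₀) : β * (cntN X i / n) ≤ β :=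
  mul_le_of_le_one_right H.beta_nonneg (cntFrac_le_one X i)

theorem percExp_big_sq_le (H : OneSupercritical X i β κ s s₁ η r₀) {v : Fin n} (hv : X v = i) :
    percExp (monoPairs X) (Real.exp (-(β / n))) (fun E =>
      if ((clus E {v}).card : ℝ) ≤ 2 / 3 * s * cntN X i then 0
        else ((clus E {v}).card - s * cntN X i) ^ 2)
      ≤ (2 * (cntN X i * Real.exp β ^ 2) + 2) / (κ * (2 / 3 * s₁)) ^ 2 := by
  have hS : ∀ w ∈ ({v} : Finset (Fin n)), X w = i := by simp [hv]
  have h := percExp_survival_sq_le hS H.beta_nonneg H.card_pos H.mean_degree_le H.kappa_pos.le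
    H.kappa_le H.s_pos H.s_lt_one H.s_eq
  have hN : (0 : ℝ) < cntN X i := by exact_mod_cast H.card_pos
  have hD : 0 < κ * (2 / 3 * s₁) := mul_pos H.kappa_pos (mul_pos (by norm_num) H.s₁_pos)
  rw [Finset.card_singleton, Nat.cast_one, one_pow, mul_one] at h
  rw [le_div_iff₀ (pow_pos hD 2), mul_comm, ← percExp_const_mul]
  refine (percExp_mono H.exp_nonneg'.1 H.exp_nonneg'.2 fun E _ => ?_).trans h
  split_ifs with hc
  · rw [mul_zero]; positivity
  · rw [not_le] at hc
    generalize ((clus E {v}).card : ℝ) = c at hc ⊢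
    generalize (cntN X i : ℝ) = N at hc hN ⊢
    rw [← mul_pow, ← sq_abs]
    refine pow_le_pow_left₀ (abs_nonneg _) ?_ 2
    rw [abs_mul, abs_of_pos hD]
    have h1 : |c - s * N| = N * |s - c / N| := by
      rw [abs_sub_comm, ← abs_of_pos hN, ← abs_mul, abs_of_pos hN, mul_sub,
        mul_div_cancel₀ _ hN.ne', mul_comm]
    rw [h1]
    have h2 : 2 / 3 * s₁ * N ≤ c := by
      have := mul_le_mul_of_nonneg_right H.s₁_le hN.le
      linarith
    calc κ * (2 / 3 * s₁) * (N * |s - c / N|) = κ * (2 / 3 * s₁ * N) * |s - c / N| := by ring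
      _ ≤ κ * c * |s - c / N| := mul_le_mul_of_nonneg_right
          (mul_le_mul_of_nonneg_left h2 H.kappa_pos.le) (abs_nonneg _)

theorem percExp_small_le (H : OneSupercritical X i β κ s s₁ η r₀) {v : Fin n} (hv : X v = i) :
    percExp (monoPairs X) (Real.exp (-(β / n))) (fun E =>
      if ((clus E {v}).card : ℝ) ≤ 2 / 3 * s * cntN X i then ((clus E {v}).card : ℝ) else 0)
      ≤ 1 / (η * (κ * s₁ / 6)) := by
  have hS : ∀ w ∈ ({v} : Finset (Fin n)), X w = i := by simp [hv]
  have h := percExp_small_exp_le hS H.beta_nonneg H.card_pos H.mean_degree_le H.kappa_pos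
    H.kappa_le H.s_pos H.s_lt_one H.s_eq H.s₁_le H.eta_pos H.eta_le
  have hb : 0 < η * (κ * s₁ / 6) :=
    mul_pos H.eta_pos (div_pos (mul_pos H.kappa_pos H.s₁_pos) (by norm_num))
  have h1 : ((1 + η) ^ ({v} : Finset (Fin n)).card)⁻¹ ≤ 1 := by
    rw [Finset.card_singleton, pow_one]
    exact inv_le_one_of_one_le₀ (by linarith [H.eta_pos])
  rw [le_div_iff₀ hb, mul_comm, ← percExp_const_mul]
  refine (percExp_mono H.exp_nonneg'.1 H.exp_nonneg'.2 fun E _ => ?_).trans (h.trans h1)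
  split_ifs
  · linarith [Real.add_one_le_exp (η * (κ * s₁ / 6) * (clus E {v}).card)]
  · rw [mul_zero]

theorem percExp_two_big_le (H : OneSupercritical X i β κ s s₁ η r₀) {u v : Fin n}
    (hu : X u = i) (hv : X v = i) :
    percExp (monoPairs X) (Real.exp (-(β / n))) (fun E =>
      if 2 / 3 * s * cntN X i < (clus E {u}).card ∧ 2 / 3 * s * cntN X i < (clus E {v}).card ∧
        ¬ (graphOf E).Reachable u v then 1 else 0)
      ≤ (2 * (cntN X i * Real.exp β ^ 2) + 8) / (κ * (4 / 9 * s₁ ^ 2) * cntN X i) ^ 2 := by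
  have hS : ∀ w ∈ ({u, v} : Finset (Fin n)), X w = i := by
    intro w hw
    rcases Finset.mem_insert.1 hw with rfl | hw
    · exact hu
    · rw [Finset.mem_singleton.1 hw, hv]
  have h := percExp_survival_sq_le hS H.beta_nonneg H.card_pos H.mean_degree_le H.kappa_pos.le
    H.kappa_le H.s_pos H.s_lt_one H.s_eq
  have hN : (0 : ℝ) < cntN X i := by exact_mod_cast H.card_pos
  have hD : 0 < κ * (4 / 9 * s₁ ^ 2) * cntN X i :=
    mul_pos (mul_pos H.kappa_pos (mul_pos (by norm_num) (pow_pos H.s₁_pos 2))) hN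
  have hcard : (({u, v} : Finset (Fin n)).card : ℝ) ^ 2 ≤ 4 := by
    have h2 : (({u, v} : Finset (Fin n)).card : ℝ) ≤ 2 := by exact_mod_cast Finset.card_le_two
    nlinarith [Nat.cast_nonneg (α := ℝ) ({u, v} : Finset (Fin n)).card]
  have h' : 2 * (cntN X i * Real.exp β ^ 2) + 2 * (({u, v} : Finset (Fin n)).card : ℝ) ^ 2
      ≤ 2 * (cntN X i * Real.exp β ^ 2) + 8 := by linarith
  rw [le_div_iff₀ (pow_pos hD 2), mul_comm, ← percExp_const_mul]
  refine (percExp_mono H.exp_nonneg'.1 H.exp_nonneg'.2 fun E _ => ?_).trans (h.trans h')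
  split_ifs with hc
  · obtain ⟨h1, h2, h3⟩ := hc
    have hdisj : Disjoint (clus E {u}) (clus E {v}) := by
      rw [Finset.disjoint_left]
      intro w hwu hwv
      exact h3 ((mem_clus_singleton.1 hwu).trans (mem_clus_singleton.1 hwv).symm)
    have hsub : clus E {u} ∪ clus E {v} ⊆ clus E {u, v} :=
      Finset.union_subset (clus_subset_clus (by simp)) (clus_subset_clus (by simp))
    have h4 : ((clus E {u}).card : ℝ) + (clus E {v}).card ≤ (clus E {u, v}).card := by
      rw [← Nat.cast_add, ← Finset.card_union_of_disjoint hdisj]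
      exact_mod_cast Finset.card_le_card hsub
    have h5 : 4 / 3 * s * cntN X i ≤ (clus E {u, v}).card := by linarith
    generalize ((clus E {u, v}).card : ℝ) = c at h5 ⊢
    clear h h' h1 h2 h4
    generalize (cntN X i : ℝ) = N at *
    rw [mul_one]
    refine pow_le_pow_left₀ hD.le ?_ 2
    have h6 : s / 3 ≤ |s - c / N| := by
      have : 4 / 3 * s ≤ c / N := by rwa [le_div_iff₀ hN]
      rw [abs_sub_comm]
      exact le_trans (by linarith) (le_abs_self _)
    have h7 : s₁ ^ 2 ≤ s ^ 2 := pow_le_pow_left₀ H.s₁_pos.le H.s₁_le 2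
    have hs := H.s_pos
    calc κ * (4 / 9 * s₁ ^ 2) * N ≤ κ * (4 / 9 * s ^ 2) * N :=
          mul_le_mul_of_nonneg_right
            (mul_le_mul_of_nonneg_left (by linarith) H.kappa_pos.le) hN.le
      _ = κ * (4 / 3 * s * N) * (s / 3) := by ring
      _ ≤ κ * c * |s - c / N| := by
          have hκ := H.kappa_pos
          have : 0 ≤ c := le_trans (by positivity) h5
          exact mul_le_mul (mul_le_mul_of_nonneg_left h5 hκ.le) h6 (by positivity) (by positivity)
  · rw [mul_zero]; positivity

theorem percExp_no_big_le (H : OneSupercritical X i β κ s s₁ η r₀) {S : Finset (Fin n)}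
    (hS : ∀ v ∈ S, X v = i) (hS0 : 0 < S.card) :
    percExp (monoPairs X) (Real.exp (-(β / n))) (fun E =>
      if ∀ v, X v = i → ((clus E {v}).card : ℝ) ≤ 2 / 3 * s * cntN X i then 1 else 0)
      ≤ 1 / (η * S.card) + S.card * (1 / (η * (κ * s₁ / 6))) / (2 / 3 * s₁ * cntN X i) := by
  have h := percExp_small_exp_le hS H.beta_nonneg H.card_pos H.mean_degree_le H.kappa_pos
    H.kappa_le H.s_pos H.s_lt_one H.s_eq H.s₁_le H.eta_pos H.eta_le
  have hN : (0 : ℝ) < cntN X i := by exact_mod_cast H.card_pos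
  have hb : 0 < η * (κ * s₁ / 6) :=
    mul_pos H.eta_pos (div_pos (mul_pos H.kappa_pos H.s₁_pos) (by norm_num))
  have hD : 0 < 2 / 3 * s₁ * cntN X i := mul_pos (mul_pos (by norm_num) H.s₁_pos) hN
  have hη := H.eta_pos
  have hS0' : (0 : ℝ) < S.card := by exact_mod_cast hS0
  have h1 : ((1 + η) ^ S.card)⁻¹ ≤ 1 / (η * S.card) := by
    rw [← one_div]
    refine one_div_le_one_div_of_le (by positivity) ?_
    have := one_add_mul_le_pow (by linarith : -2 ≤ η) S.card
    linarith
  have h2 : percExp (monoPairs X) (Real.exp (-(β / n))) (fun E => ∑ v ∈ S,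
      if ((clus E {v}).card : ℝ) ≤ 2 / 3 * s * cntN X i then ((clus E {v}).card : ℝ) else 0)
      ≤ S.card * (1 / (η * (κ * s₁ / 6))) := by
    rw [percExp_sum, ← nsmul_eq_mul]
    exact Finset.sum_le_card_nsmul _ _ _ fun v hv => H.percExp_small_le (hS v hv)
  have h3 := div_le_div_of_nonneg_right h2 hD.le
  refine le_trans ?_ (add_le_add (h.trans h1) h3)
  rw [div_eq_inv_mul _ (2 / 3 * s₁ * (cntN X i : ℝ)), ← percExp_const_mul, ← percExp_add]
  refine percExp_mono H.exp_nonneg'.1 H.exp_nonneg'.2 fun E _ => ?_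
  have hsum0 : 0 ≤ ∑ v ∈ S, (if ((clus E {v}).card : ℝ) ≤ 2 / 3 * s * cntN X i
      then ((clus E {v}).card : ℝ) else 0) :=
    Finset.sum_nonneg fun v _ => by split_ifs <;> positivity
  have hfirst0 : 0 ≤ (if ((clus E S).card : ℝ) ≤ 2 / 3 * s * cntN X i then
        Real.exp (η * (κ * s₁ / 6) * (clus E S).card) else 0) := by
    split_ifs
    · exact (Real.exp_pos _).le
    · exact le_rfl
  by_cases hall : ∀ v, X v = i → ((clus E {v}).card : ℝ) ≤ 2 / 3 * s * cntN X i
  · rw [if_pos hall]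
    by_cases hc : ((clus E S).card : ℝ) ≤ 2 / 3 * s * cntN X i
    · rw [if_pos hc]
      have : 1 ≤ Real.exp (η * (κ * s₁ / 6) * (clus E S).card) :=
        Real.one_le_exp (by positivity)
      have := mul_nonneg (inv_nonneg.2 hD.le) hsum0
      linarith
    · rw [if_neg hc, zero_add, ← div_eq_inv_mul, le_div_iff₀ hD, one_mul]
      rw [not_le] at hc
      have hle : (clus E S).card ≤ ∑ v ∈ S, (clus E {v}).card := by
        refine le_trans (Finset.card_le_card ?_) Finset.card_biUnion_le
        intro w hw
        obtain ⟨v, hv, hvw⟩ := mem_clus.1 hw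
        exact Finset.mem_biUnion.2 ⟨v, hv, mem_clus_singleton.2 hvw⟩
      have hle' : ((clus E S).card : ℝ) ≤ ∑ v ∈ S, ((clus E {v}).card : ℝ) := by
        exact_mod_cast hle
      have heq : ∑ v ∈ S, (if ((clus E {v}).card : ℝ) ≤ 2 / 3 * s * cntN X i
          then ((clus E {v}).card : ℝ) else 0) = ∑ v ∈ S, ((clus E {v}).card : ℝ) :=
        Finset.sum_congr rfl fun v hv => if_pos (hall v (hS v hv))
      rw [heq]
      have := mul_le_mul_of_nonneg_right H.s₁_le hN.le
      linarith
  · rw [if_neg hall]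
    exact add_nonneg hfirst0 (mul_nonneg (inv_nonneg.2 hD.le) hsum0)

end OneSupercritical

theorem abs_div_le_sq {n : ℕ} (hn : 0 < n) (z : ℝ) :
    |z| / n ≤ (z ^ 2 / n + 1) / (2 * √n) := by
  have hn' : (0 : ℝ) < √n := Real.sqrt_pos.2 (by exact_mod_cast hn)
  have hsq : (n : ℝ) = √n ^ 2 := (Real.sq_sqrt (Nat.cast_nonneg n)).symm
  rw [hsq, Real.sqrt_sq hn'.le]
  generalize √(n : ℝ) = w at hn'
  rw [← sq_abs z]
  generalize |z| = a
  rw [div_le_div_iff₀ (by positivity) (by positivity)]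
  have h : a ^ 2 / w ^ 2 + 1 = (a ^ 2 + w ^ 2) / w ^ 2 := by field_simp
  rw [h, div_mul_cancel₀ _ (by positivity)]
  nlinarith [mul_nonneg hn'.le (sq_nonneg (a - w)), sq_nonneg (a - w)]

theorem cntN_eq_add {n q : ℕ} (τ : Conf n q) (G : Finset (Fin n)) {k : Fin q}
    (hG : ∀ v ∈ G, τ v = k) (j : Fin q) :
    (cntN τ j : ℝ) = (if j = k then (G.card : ℝ) else 0)
      + ((Gᶜ.filter (fun v => τ v = j)).card : ℝ) := by
  unfold cntN
  rw [Finset.card_filter, Finset.card_filter, ← Finset.sum_add_sum_compl G, Nat.cast_add]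
  congr 1
  rw [Finset.sum_congr rfl (g := fun _ => if j = k then 1 else 0) fun v hv => by
    rw [hG v hv]; exact if_congr eq_comm rfl rfl]
  split_ifs <;> simp

theorem linf_alphaVec_le_of_giant {n q : ℕ} (hq : 2 ≤ q) (hn : 0 < n) (τ : Conf n q)
    (G : Finset (Fin n)) {k : Fin q} (hG : ∀ v ∈ G, τ v = k) {y : ℝ} (hy0 : 0 ≤ y) :
    linf (alphaVec τ) (kappaVec q (y + (1 - y) / q)) ≤ |(G.card : ℝ) / n - y|
      + ∑ j : Fin q, |((Gᶜ.filter (fun v => τ v = j)).card : ℝ) - Gᶜ.card / q| / n := by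
  have hn' : (n : ℝ) ≠ 0 := by positivity
  have hq' : (2 : ℝ) ≤ q := by exact_mod_cast hq
  have hq0 : (q : ℝ) ≠ 0 := by positivity
  have hq1 : (q : ℝ) - 1 ≠ 0 := by linarith
  have hother : (1 - (y + (1 - y) / q)) / ((q : ℝ) - 1) = (1 - y) / q := by
    field_simp
    ring
  have hcompl : (Gᶜ.card : ℝ) = n - G.card := by
    rw [Finset.card_compl, Fintype.card_fin, Nat.cast_sub]
    simpa using Finset.card_le_univ G
  have hle : ∀ j : Fin q, |((Gᶜ.filter (fun v => τ v = j)).card : ℝ) - Gᶜ.card / q| / n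
      ≤ ∑ j : Fin q, |((Gᶜ.filter (fun v => τ v = j)).card : ℝ) - Gᶜ.card / q| / n := fun j =>
    Finset.single_le_sum (f := fun j : Fin q =>
      |((Gᶜ.filter (fun v => τ v = j)).card : ℝ) - Gᶜ.card / q| / n)
      (fun j _ => by positivity) (Finset.mem_univ j)
  have habs : ∀ j : Fin q, |((Gᶜ.filter (fun v => τ v = j)).card : ℝ) - Gᶜ.card / q| / n
      = |(((Gᶜ.filter (fun v => τ v = j)).card : ℝ) - Gᶜ.card / q) / n| := fun j => by
    rw [abs_div, Nat.abs_cast]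
  refine linf_alphaVec_kappaVec_le hq τ k ?_ ?_ ?_
  · refine le_trans ?_ (add_le_add_right (hle k) _)
    have h : cntFrac τ k - (y + (1 - y) / q) = (1 - 1 / q) * ((G.card : ℝ) / n - y)
        + (((Gᶜ.filter (fun v => τ v = k)).card : ℝ) - Gᶜ.card / q) / n := by
      unfold cntFrac
      rw [cntN_eq_add τ G hG, if_pos rfl, hcompl]
      field_simp
      ring
    rw [h, habs]
    refine (abs_add_le _ _).trans (add_le_add_left ?_ _)
    rw [abs_mul]
    refine mul_le_of_le_one_left (abs_nonneg _) ?_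
    have : 0 ≤ 1 / (q : ℝ) := by positivity
    have h1 : 1 / (q : ℝ) ≤ 1 := by
      rw [div_le_one (by positivity)]; linarith
    rw [abs_le]
    constructor <;> linarith
  · intro j hj
    rw [hother]
    refine le_trans ?_ (add_le_add_right (hle j) _)
    have h : cntFrac τ j - (1 - y) / q = -(1 / q) * ((G.card : ℝ) / n - y)
        + (((Gᶜ.filter (fun v => τ v = j)).card : ℝ) - Gᶜ.card / q) / n := by
      unfold cntFrac
      rw [cntN_eq_add τ G hG, if_neg hj, hcompl]
      field_simp
      ring
    rw [h, habs]
    refine (abs_add_le _ _).trans (add_le_add_left ?_ _)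
    rw [abs_mul, abs_neg]
    refine mul_le_of_le_one_left (abs_nonneg _) ?_
    rw [abs_of_nonneg (by positivity), div_le_one (by positivity)]
    linarith
  · rw [hother]; linarith

theorem colAvg_linf_le {n q : ℕ} (hq : 2 ≤ q) (hn : 0 < n) (E : Finset (Fin n × Fin n))
    (g : Fin n) {y : ℝ} (hy0 : 0 ≤ y) :
    colAvg E (fun τ : Conf n q => linf (alphaVec τ) (kappaVec q (y + (1 - y) / q)))
      ≤ |((clus E {g}).card : ℝ) / n - y|
        + q * ((∑ v ∈ (clus E {g})ᶜ, ((clus E {v}).card : ℝ)) / n + 1) / (2 * √n) := by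
  set G := clus E {g} with hG
  have hq0 : 0 < q := by omega
  have hw : (0 : ℝ) ≤ 2 * √n := by positivity
  have h1 : colAvg E (fun τ : Conf n q => linf (alphaVec τ) (kappaVec q (y + (1 - y) / q)))
      ≤ colAvg E (fun τ : Conf n q => |(G.card : ℝ) / n - y| + ∑ j : Fin q,
        ((1 / n / (2 * √n)) * (((Gᶜ.filter (fun v => τ v = j)).card : ℝ) - Gᶜ.card / q) ^ 2
          + 1 / (2 * √n))) := by
    refine colAvg_mono fun τ hτ => ?_
    refine (linf_alphaVec_le_of_giant hq hn τ G (k := τ g)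
      (fun v hv => (hτ g v (mem_clus_singleton.1 hv)).symm) hy0).trans ?_
    refine add_le_add_right (Finset.sum_le_sum fun j _ => ?_) _
    refine (abs_div_le_sq hn _).trans (le_of_eq ?_)
    ring
  refine h1.trans ?_
  rw [colAvg_add, colAvg_const hq0, colAvg_sum]
  refine add_le_add_right ?_ _
  have h2 : ∀ j ∈ (Finset.univ : Finset (Fin q)), colAvg E (fun τ : Conf n q =>
      (1 / n / (2 * √n)) * (((Gᶜ.filter (fun v => τ v = j)).card : ℝ) - Gᶜ.card / q) ^ 2
          + 1 / (2 * √n)) ≤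
      ((∑ v ∈ Gᶜ, ((clus E {v}).card : ℝ)) / n + 1) / (2 * √n) := by
    intro j _
    rw [colAvg_add, colAvg_const hq0, colAvg_const_mul]
    have h3 := mul_le_mul_of_nonneg_left (colAvg_sq_count_le (E := E) hq0 j Gᶜ)
      (by positivity : (0 : ℝ) ≤ 1 / n / (2 * √n))
    refine (add_le_add_left h3 _).trans (le_of_eq ?_)
    ring
  refine (Finset.sum_le_card_nsmul _ _ _ h2).trans (le_of_eq ?_)
  rw [Finset.card_univ, Fintype.card_fin, nsmul_eq_mul, mul_div_assoc]

section giant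
variable {n q : ℕ} (X : Conf n q) (i : Fin q) (s : ℝ) (E : Finset (Fin n × Fin n))

/-- Sum, over the vertices of spin `i` in a large cluster, of the squared deviation of the
cluster size from `s * cntN X i`. -/
noncomputable def bigDeviation : ℝ :=
  ∑ v ∈ Finset.univ.filter (fun v => X v = i),
    if ((clus E {v}).card : ℝ) ≤ 2 / 3 * s * cntN X i then 0
      else ((clus E {v}).card - s * cntN X i) ^ 2

/-- Sum of the cluster sizes over all vertices that are not in a large cluster of spin `i`. -/
noncomputable def smallMass : ℝ :=
  ∑ v ∈ (Finset.univ.filter (fun v => X v = i))ᶜ, ((clus E {v}).card : ℝ)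
    + ∑ v ∈ Finset.univ.filter (fun v => X v = i),
      if ((clus E {v}).card : ℝ) ≤ 2 / 3 * s * cntN X i then ((clus E {v}).card : ℝ) else 0

/-- Indicator that spin `i` has no large cluster. -/
noncomputable def noBig : ℝ :=
  if ∀ v, X v = i → ((clus E {v}).card : ℝ) ≤ 2 / 3 * s * cntN X i then 1 else 0

/-- Number of pairs of vertices of spin `i` in different large clusters. -/
noncomputable def splitPairs : ℝ :=
  ∑ u ∈ Finset.univ.filter (fun v => X v = i), ∑ v ∈ Finset.univ.filter (fun v => X v = i),
    if 2 / 3 * s * cntN X i < (clus E {u}).card ∧ 2 / 3 * s * cntN X i < (clus E {v}).card ∧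
      ¬ (graphOf E).Reachable u v then 1 else 0

theorem bigDeviation_nonneg : 0 ≤ bigDeviation X i s E :=
  Finset.sum_nonneg fun v _ => by split_ifs <;> positivity

theorem smallMass_nonneg : 0 ≤ smallMass X i s E :=
  add_nonneg (Finset.sum_nonneg fun v _ => by positivity)
    (Finset.sum_nonneg fun v _ => by split_ifs <;> positivity)

theorem noBig_nonneg : 0 ≤ noBig X i s E := by
  unfold noBig; split_ifs <;> norm_num

theorem splitPairs_nonneg : 0 ≤ splitPairs X i s E :=
  Finset.sum_nonneg fun u _ => Finset.sum_nonneg fun v _ => by split_ifs <;> norm_num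

variable {X i s E}

theorem clus_singleton_color (hE : E ⊆ monoPairs X) {g : Fin n} (hg : X g = i) :
    ∀ v ∈ clus E {g}, X v = i :=
  clus_color hE (by simp [hg])

theorem sq_le_splitPairs (hE : E ⊆ monoPairs X) {u v : Fin n} (hu : X u = i) (hv : X v = i)
    (hbu : 2 / 3 * s * cntN X i < (clus E {u}).card)
    (hbv : 2 / 3 * s * cntN X i < (clus E {v}).card) (huv : ¬ (graphOf E).Reachable u v) :
    ((clus E {u}).card : ℝ) * (clus E {v}).card ≤ splitPairs X i s E := by
  have hsub : ∀ {g : Fin n}, X g = i → clus E {g} ⊆ Finset.univ.filter (fun v => X v = i) :=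
    fun {g} hg w hw => by simpa using clus_singleton_color hE hg w hw
  have h1 : ((clus E {u}).card : ℝ) * (clus E {v}).card
      = ∑ a ∈ clus E {u}, ∑ b ∈ clus E {v}, (1 : ℝ) := by simp
  rw [h1]
  unfold splitPairs
  have hnn : ∀ a b : Fin n, (0 : ℝ) ≤ if 2 / 3 * s * cntN X i < (clus E {a}).card ∧
      2 / 3 * s * cntN X i < (clus E {b}).card ∧ ¬ (graphOf E).Reachable a b then 1 else 0 :=
    fun a b => by split_ifs <;> norm_num
  refine le_trans (Finset.sum_le_sum fun a ha => ?_)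
    (Finset.sum_le_sum_of_subset_of_nonneg (hsub hu)
      fun a _ _ => Finset.sum_nonneg fun b _ => hnn a b)
  refine le_trans (Finset.sum_le_sum fun b hb => ?_)
    (Finset.sum_le_sum_of_subset_of_nonneg (hsub hv) fun b _ _ => hnn a b)
  rw [mem_clus_singleton] at ha hb
  rw [if_pos]
  rw [← clus_singleton_congr ha, ← clus_singleton_congr hb]
  exact ⟨hbu, hbv, fun hab => huv (ha.trans (hab.trans hb.symm))⟩

theorem card_mul_sq_le_bigDeviation (hE : E ⊆ monoPairs X) {g : Fin n} (hg : X g = i)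
    (hbg : 2 / 3 * s * cntN X i < (clus E {g}).card) :
    ((clus E {g}).card : ℝ) * ((clus E {g}).card - s * cntN X i) ^ 2 ≤ bigDeviation X i s E := by
  unfold bigDeviation
  have hsub : clus E {g} ⊆ Finset.univ.filter (fun v => X v = i) :=
    fun w hw => by simpa using clus_singleton_color hE hg w hw
  refine le_trans (le_of_eq ?_) (Finset.sum_le_sum_of_subset_of_nonneg hsub
    fun a _ _ => by split_ifs <;> positivity)
  rw [← nsmul_eq_mul, ← Finset.sum_const]
  refine Finset.sum_congr rfl fun a ha => ?_
  rw [mem_clus_singleton] at ha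
  rw [← clus_singleton_congr ha, if_neg (not_le.2 hbg)]

theorem sum_compl_clus_le_smallMass {g : Fin n}
    (h : ∀ v, X v = i → 2 / 3 * s * cntN X i < (clus E {v}).card → (graphOf E).Reachable g v) :
    ∑ v ∈ (clus E {g})ᶜ, ((clus E {v}).card : ℝ) ≤ smallMass X i s E := by
  have h1 : ∀ v ∈ (clus E {g})ᶜ, ((clus E {v}).card : ℝ) ≤ if X v = i then
      (if ((clus E {v}).card : ℝ) ≤ 2 / 3 * s * cntN X i then ((clus E {v}).card : ℝ) else 0)
      else ((clus E {v}).card : ℝ) := by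
    intro v hv
    split_ifs with h2 h3
    · exact le_rfl
    · rw [Finset.mem_compl, mem_clus_singleton] at hv
      exact absurd (h v h2 (not_le.1 h3)) hv
    · exact le_rfl
  refine (Finset.sum_le_sum h1).trans ((Finset.sum_le_sum_of_subset_of_nonneg
    (Finset.subset_univ _) fun v _ _ => by split_ifs <;> positivity).trans (le_of_eq ?_))
  rw [← Finset.sum_compl_add_sum (Finset.univ.filter (fun v => X v = i))]
  unfold smallMass
  congr 1
  · exact Finset.sum_congr rfl fun v hv => if_neg (by simpa using hv)
  · exact Finset.sum_congr rfl fun v hv => if_pos (by simpa using hv)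

end giant

namespace OneSupercritical
variable {n q : ℕ} {X : Conf n q} {i : Fin q} {β κ s s₁ η r₀ : ℝ}

theorem colAvg_linf_le (H : OneSupercritical X i β κ s s₁ η r₀) (hq : 2 ≤ q) (hn : 0 < n)
    {E : Finset (Fin n × Fin n)} (hE : E ⊆ monoPairs X) :
    colAvg E (fun τ : Conf n q => linf (alphaVec τ)
      (kappaVec q (s * (cntN X i / n) + (1 - s * (cntN X i / n)) / q)))
      ≤ (bigDeviation X i s E / (2 / 3 * s₁ * cntN X i) / n + 1) / (2 * √n)
        + q * (smallMass X i s E / n + 1) / (2 * √n) + noBig X i s E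
        + splitPairs X i s E / (2 / 3 * s₁ * cntN X i) ^ 2 := by
  have hN : (0 : ℝ) < cntN X i := by exact_mod_cast H.card_pos
  have hs₁ := H.s₁_pos
  have hs := H.s_pos
  have hD : 0 < 2 / 3 * s₁ * cntN X i := by positivity
  have hDs : 2 / 3 * s₁ * cntN X i ≤ 2 / 3 * s * cntN X i := by
    have := mul_le_mul_of_nonneg_right H.s₁_le hN.le
    linarith
  have hq0 : 0 < q := by omega
  have hq' : (2 : ℝ) ≤ q := by exact_mod_cast hq
  have hx0 : 0 ≤ (cntN X i : ℝ) / n := cntFrac_nonneg X i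
  have hx1 : (cntN X i : ℝ) / n ≤ 1 := cntFrac_le_one X i
  have hy0 : 0 ≤ s * ((cntN X i : ℝ) / n) := mul_nonneg hs.le hx0
  have hy1 : s * ((cntN X i : ℝ) / n) ≤ 1 := mul_le_one₀ H.s_lt_one.le hx0 hx1
  have hT1 : 0 ≤ (bigDeviation X i s E / (2 / 3 * s₁ * cntN X i) / n + 1) / (2 * √n) := by
    have := bigDeviation_nonneg X i s E
    positivity
  have hT2 : 0 ≤ q * (smallMass X i s E / n + 1) / (2 * √n) := by
    have := smallMass_nonneg X i s E
    positivity
  have hT3 := noBig_nonneg X i s E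
  have hT4 : 0 ≤ splitPairs X i s E / (2 / 3 * s₁ * cntN X i) ^ 2 :=
    div_nonneg (splitPairs_nonneg X i s E) (by positivity)
  have hone : colAvg E (fun τ : Conf n q => linf (alphaVec τ)
      (kappaVec q (s * (cntN X i / n) + (1 - s * (cntN X i / n)) / q))) ≤ 1 := by
    refine (colAvg_mono (ψ := fun _ => 1) fun τ _ => ?_).trans (colAvg_const hq0 1).le
    have h1 : 0 ≤ (1 - s * ((cntN X i : ℝ) / n)) / q := div_nonneg (by linarith) (by positivity)
    have h2 : (1 - s * ((cntN X i : ℝ) / n)) / q ≤ 1 - s * ((cntN X i : ℝ) / n) :=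
      div_le_self (by linarith) (by linarith)
    exact linf_alphaVec_le_one hq τ (by linarith) (by linarith)
  by_cases hno : ∀ v, X v = i → ((clus E {v}).card : ℝ) ≤ 2 / 3 * s * cntN X i
  · have : noBig X i s E = 1 := if_pos hno
    linarith
  push Not at hno
  obtain ⟨g, hg, hbg⟩ := hno
  by_cases hsplit : ∀ v, X v = i → 2 / 3 * s * cntN X i < (clus E {v}).card →
      (graphOf E).Reachable g v
  · refine (_root_.colAvg_linf_le hq hn E g hy0).trans ?_
    have h1 := sum_compl_clus_le_smallMass hsplit
    have h2 : q * ((∑ v ∈ (clus E {g})ᶜ, ((clus E {v}).card : ℝ)) / n + 1) / (2 * √n)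
        ≤ q * (smallMass X i s E / n + 1) / (2 * √n) := by gcongr
    have h3 : |((clus E {g}).card : ℝ) / n - s * (cntN X i / n)|
        ≤ (bigDeviation X i s E / (2 / 3 * s₁ * cntN X i) / n + 1) / (2 * √n) := by
      have h4 : ((clus E {g}).card : ℝ) / n - s * (cntN X i / n)
          = ((clus E {g}).card - s * cntN X i) / n := by ring
      rw [h4, abs_div, Nat.abs_cast]
      refine (abs_div_le_sq hn _).trans ?_
      have h5 : (((clus E {g}).card : ℝ) - s * cntN X i) ^ 2
          ≤ bigDeviation X i s E / (2 / 3 * s₁ * cntN X i) := by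
        rw [le_div_iff₀ hD, mul_comm]
        refine le_trans ?_ (card_mul_sq_le_bigDeviation hE hg hbg)
        exact mul_le_mul_of_nonneg_right (hDs.trans hbg.le) (sq_nonneg _)
      gcongr
    linarith
  · push Not at hsplit
    obtain ⟨v, hv, hbv, hgv⟩ := hsplit
    have h1 := sq_le_splitPairs hE hg hv hbg hbv hgv
    have h2 : 1 ≤ splitPairs X i s E / (2 / 3 * s₁ * cntN X i) ^ 2 := by
      rw [le_div_iff₀ (by positivity), one_mul, sq]
      exact (mul_le_mul (hDs.trans hbg.le) (hDs.trans hbv.le) hD.le (by positivity)).trans h1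
    linarith

theorem percExp_bigDeviation_le (H : OneSupercritical X i β κ s s₁ η r₀) :
    percExp (monoPairs X) (Real.exp (-(β / n))) (bigDeviation X i s)
      ≤ cntN X i * ((2 * (cntN X i * Real.exp β ^ 2) + 2) / (κ * (2 / 3 * s₁)) ^ 2) := by
  unfold bigDeviation
  rw [percExp_sum, ← nsmul_eq_mul]
  exact Finset.sum_le_card_nsmul _ _ _ fun v hv => H.percExp_big_sq_le (by simpa using hv)

theorem percExp_smallMass_le (H : OneSupercritical X i β κ s s₁ η r₀) :
    percExp (monoPairs X) (Real.exp (-(β / n))) (smallMass X i s)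
      ≤ n * (2 / (1 - r₀) + 1 / (η * (κ * s₁ / 6))) := by
  unfold smallMass
  have hb : 0 < η * (κ * s₁ / 6) :=
    mul_pos H.eta_pos (div_pos (mul_pos H.kappa_pos H.s₁_pos) (by norm_num))
  have hr : 0 < 1 - r₀ := by linarith [H.r₀_lt_one]
  rw [percExp_add, percExp_sum, percExp_sum, mul_add]
  have hcard : ∀ A : Finset (Fin n), (A.card : ℝ) ≤ n := fun A => by
    exact_mod_cast (Finset.card_le_univ A).trans (Fintype.card_fin n).le
  refine add_le_add ?_ ?_
  · refine (Finset.sum_le_card_nsmul _ _ (2 / (1 - r₀)) fun v hv => ?_).trans ?_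
    · exact percExp_card_clus_le_of_subcritical (i := X v) rfl H.beta_nonneg H.r₀_lt_one
        H.r₀_nonneg (H.subcritical _ (by simpa using hv))
    · rw [nsmul_eq_mul]
      exact mul_le_mul_of_nonneg_right (hcard _) (by positivity)
  · refine (Finset.sum_le_card_nsmul _ _ _
      fun v hv => H.percExp_small_le (by simpa using hv)).trans ?_
    rw [nsmul_eq_mul]
    exact mul_le_mul_of_nonneg_right (hcard _) (by positivity)

theorem percExp_splitPairs_le (H : OneSupercritical X i β κ s s₁ η r₀) :
    percExp (monoPairs X) (Real.exp (-(β / n))) (splitPairs X i s)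
      ≤ cntN X i * (cntN X i * ((2 * (cntN X i * Real.exp β ^ 2) + 8) /
        (κ * (4 / 9 * s₁ ^ 2) * cntN X i) ^ 2)) := by
  unfold splitPairs
  rw [percExp_sum, ← nsmul_eq_mul]
  refine Finset.sum_le_card_nsmul _ _ _ fun u hu => ?_
  rw [percExp_sum, ← nsmul_eq_mul]
  exact Finset.sum_le_card_nsmul _ _ _ fun v hv =>
    H.percExp_two_big_le (by simpa using hu) (by simpa using hv)

theorem percExp_noBig_le (H : OneSupercritical X i β κ s s₁ η r₀) :
    percExp (monoPairs X) (Real.exp (-(β / n))) (noBig X i s)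
      ≤ (2 / η + 1 / (η * (κ * s₁ / 6)) / (2 / 3 * s₁)) / √(cntN X i) := by
  have hNpos := H.card_pos
  have hb : 0 < η * (κ * s₁ / 6) :=
    mul_pos H.eta_pos (div_pos (mul_pos H.kappa_pos H.s₁_pos) (by norm_num))
  have hη := H.eta_pos
  have hs₁ := H.s₁_pos
  obtain ⟨S, hSA, hScard⟩ := Finset.exists_subset_card_eq
    (show Nat.sqrt (cntN X i) ≤ (Finset.univ.filter (fun v => X v = i)).card from
      Nat.sqrt_le_self _)
  have hS : ∀ v ∈ S, X v = i := fun v hv => by simpa using hSA hv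
  have hm : 0 < Nat.sqrt (cntN X i) := Nat.sqrt_pos.2 hNpos
  have h := H.percExp_no_big_le hS (hScard ▸ hm)
  unfold noBig
  refine h.trans ?_
  rw [hScard]
  have hN : (0 : ℝ) < cntN X i := by exact_mod_cast hNpos
  have hw : 0 < √(cntN X i : ℝ) := Real.sqrt_pos.2 hN
  have hm1 : (1 : ℝ) ≤ Nat.sqrt (cntN X i) := by exact_mod_cast hm
  have hmw : (Nat.sqrt (cntN X i) : ℝ) ≤ √(cntN X i : ℝ) := Real.nat_sqrt_le_real_sqrt
  have hwm : √(cntN X i : ℝ) ≤ 2 * Nat.sqrt (cntN X i) := by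
    have := Real.real_sqrt_le_nat_sqrt_succ (a := cntN X i)
    linarith
  have hsq : (cntN X i : ℝ) = √(cntN X i : ℝ) ^ 2 := (Real.sq_sqrt hN.le).symm
  rw [add_div]
  refine add_le_add ?_ ?_
  · rw [div_div, div_le_div_iff₀ (by positivity) (by positivity)]
    nlinarith
  · generalize (Nat.sqrt (cntN X i) : ℝ) = m at *
    rw [hsq]
    rw [Real.sqrt_sq hw.le]
    generalize √(cntN X i : ℝ) = w at *
    rw [show m * (1 / (η * (κ * s₁ / 6))) / (2 / 3 * s₁ * w ^ 2)
      = (1 / (η * (κ * s₁ / 6)) / (2 / 3 * s₁)) * (m / w ^ 2) by field_simp]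
    rw [div_eq_mul_one_div _ w]
    refine mul_le_mul_of_nonneg_left ?_ (by positivity)
    rw [div_le_div_iff₀ (by positivity) hw]
    nlinarith

end OneSupercritical

theorem exists_swStep_linf_le (q : ℕ) (hq : 2 ≤ q) {β κ s₁ η r₀ : ℝ} :
    ∃ C : ℝ, 0 ≤ C ∧ ∀ (n : ℕ) (X : Conf n q) (i : Fin q) (s : ℝ), 0 < n →
      n ≤ q * cntN X i → OneSupercritical X i β κ s s₁ η r₀ →
      ∑ τ, swStep n q β X τ * linf (alphaVec τ)
        (kappaVec q (s * (cntN X i / n) + (1 - s * (cntN X i / n)) / q)) ≤ C / √n := by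
  by_cases hpar : 0 < κ ∧ 0 < s₁ ∧ 0 < η ∧ r₀ < 1
  swap
  · refine ⟨0, le_rfl, fun n X i s _ _ H => absurd ?_ hpar⟩
    exact ⟨H.kappa_pos, H.s₁_pos, H.eta_pos, H.r₀_lt_one⟩
  obtain ⟨hκ, hs₁, hη, hr₀⟩ := hpar
  set B := Real.exp β ^ 2 with hB
  have hB0 : 0 < B := by positivity
  have hr : 0 < 1 - r₀ := by linarith
  set c1 := (2 * B + 2) / (κ * (2 / 3 * s₁)) ^ 2 / (2 / 3 * s₁) with hc1
  set c2 := 2 / (1 - r₀) + 1 / (η * (κ * s₁ / 6)) with hc2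
  set c3 := 2 / η + 1 / (η * (κ * s₁ / 6)) / (2 / 3 * s₁) with hc3
  set c4 := (2 * B + 8) / (κ * (4 / 9 * s₁ ^ 2)) ^ 2 / (2 / 3 * s₁) ^ 2 with hc4
  have h10 : 0 ≤ c1 := by positivity
  have h20 : 0 ≤ c2 := by positivity
  have h30 : 0 ≤ c3 := by positivity
  have h40 : 0 ≤ c4 := by positivity
  refine ⟨(c1 + 1) / 2 + q * (c2 + 1) / 2 + c3 * √q + c4 * √q, by positivity, ?_⟩
  intro n X i s hn hnN H
  have hn' : (0 : ℝ) < n := by exact_mod_cast hn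
  have hn1 : (1 : ℝ) ≤ n := by exact_mod_cast hn
  have hN : (0 : ℝ) < cntN X i := by exact_mod_cast H.card_pos
  have hN1 : (1 : ℝ) ≤ cntN X i := by exact_mod_cast H.card_pos
  have hw : 0 < √(n : ℝ) := Real.sqrt_pos.2 hn'
  have hW : 0 < √(cntN X i : ℝ) := Real.sqrt_pos.2 hN
  have hNn : (cntN X i : ℝ) ≤ n := by
    exact_mod_cast (Finset.card_le_univ _).trans (Fintype.card_fin n).le
  have hwW : 1 / √(cntN X i : ℝ) ≤ √q / √n := by
    rw [div_le_div_iff₀ hW hw, one_mul, ← Real.sqrt_mul (Nat.cast_nonneg q)]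
    exact Real.sqrt_le_sqrt (by exact_mod_cast hnN)
  have hWN : 1 / (cntN X i : ℝ) ≤ 1 / √(cntN X i : ℝ) := by
    refine one_div_le_one_div_of_le hW ?_
    rw [Real.sqrt_le_left hN.le]
    nlinarith
  rw [sum_swStep_mul]
  refine (percExp_mono H.exp_nonneg'.1 H.exp_nonneg'.2 fun E hE =>
    H.colAvg_linf_le hq hn (Finset.mem_powerset.1 hE)).trans ?_
  have e1 : percExp (monoPairs X) (Real.exp (-(β / n))) (fun E =>
      (bigDeviation X i s E / (2 / 3 * s₁ * cntN X i) / n + 1) / (2 * √n))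
      ≤ (c1 + 1) / 2 / √n := by
    have h := H.percExp_bigDeviation_le
    rw [← hB] at h
    have h2 : (cntN X i : ℝ) * ((2 * (cntN X i * B) + 2) / (κ * (2 / 3 * s₁)) ^ 2)
        ≤ cntN X i * (n * ((2 * B + 2) / (κ * (2 / 3 * s₁)) ^ 2)) := by
      rw [← mul_div_assoc (n : ℝ)]
      gcongr
      nlinarith
    have hrew : (fun E => (bigDeviation X i s E / (2 / 3 * s₁ * cntN X i) / n + 1) / (2 * √n))
        = fun E => (1 / (2 / 3 * s₁ * cntN X i) / n / (2 * √n)) * bigDeviation X i s E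
          + 1 / (2 * √n) := by
      funext E; ring
    rw [hrew, percExp_add, percExp_const, percExp_const_mul]
    have h3 := mul_le_mul_of_nonneg_left (h.trans h2)
      (by positivity : 0 ≤ 1 / (2 / 3 * s₁ * cntN X i) / n / (2 * √(n : ℝ)))
    refine (add_le_add_left h3 _).trans (le_of_eq ?_)
    rw [hc1]
    generalize √(n : ℝ) = w at *
    field_simp
  have e2 : percExp (monoPairs X) (Real.exp (-(β / n))) (fun E =>
      q * (smallMass X i s E / n + 1) / (2 * √n)) ≤ q * (c2 + 1) / 2 / √n := by
    have h := H.percExp_smallMass_le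
    rw [← hc2] at h
    have hrew : (fun E => q * (smallMass X i s E / n + 1) / (2 * √n))
        = fun E => (q / n / (2 * √n)) * smallMass X i s E + q / (2 * √n) := by
      funext E; ring
    rw [hrew, percExp_add, percExp_const, percExp_const_mul]
    have h3 := mul_le_mul_of_nonneg_left h (by positivity : 0 ≤ (q : ℝ) / n / (2 * √(n : ℝ)))
    refine (add_le_add_left h3 _).trans (le_of_eq ?_)
    clear_value c2
    generalize √(n : ℝ) = w at *
    field_simp
  have e3 : percExp (monoPairs X) (Real.exp (-(β / n))) (noBig X i s) ≤ c3 * √q / √n := by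
    refine H.percExp_noBig_le.trans ?_
    rw [← hc3, div_eq_mul_one_div, mul_div_assoc]
    exact mul_le_mul_of_nonneg_left hwW h30
  have e4 : percExp (monoPairs X) (Real.exp (-(β / n))) (fun E =>
      splitPairs X i s E / (2 / 3 * s₁ * cntN X i) ^ 2) ≤ c4 * √q / √n := by
    have h := H.percExp_splitPairs_le
    rw [← hB] at h
    have hrew : (fun E => splitPairs X i s E / (2 / 3 * s₁ * cntN X i) ^ 2)
        = fun E => (1 / (2 / 3 * s₁ * cntN X i) ^ 2) * splitPairs X i s E := by
      funext E; ring
    have h2 : (cntN X i : ℝ) * (cntN X i * ((2 * (cntN X i * B) + 8) /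
        (κ * (4 / 9 * s₁ ^ 2) * cntN X i) ^ 2)) ≤
        cntN X i * (cntN X i * ((cntN X i * (2 * B + 8)) /
        (κ * (4 / 9 * s₁ ^ 2) * cntN X i) ^ 2)) := by
      gcongr
      nlinarith
    rw [hrew, percExp_const_mul]
    have h3 := mul_le_mul_of_nonneg_left (h.trans h2)
      (by positivity : 0 ≤ 1 / (2 / 3 * s₁ * (cntN X i : ℝ)) ^ 2)
    refine h3.trans ?_
    calc _ = c4 * (1 / cntN X i) := by
          rw [hc4]
          generalize (cntN X i : ℝ) = N at *
          field_simp
      _ ≤ c4 * (√q / √n) := mul_le_mul_of_nonneg_left (hWN.trans hwW) h40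
      _ = _ := by ring
  rw [percExp_add, percExp_add, percExp_add, add_div, add_div, add_div]
  exact add_le_add (add_le_add (add_le_add e1 e2) e3) e4

theorem exists_swStep_drift (q : ℕ) (hq : 2 ≤ q) {β : ℝ} (hβ : (q : ℝ) < β) :
    ∃ K ε₁ C : ℝ, 0 ≤ K ∧ 0 < ε₁ ∧ 0 ≤ C ∧ ∀ (n : ℕ) (X : Conf n q), 0 < n →
      linf (alphaVec X) (mVec q β) ≤ ε₁ → ∃ b : ℝ,
        |b - aFix q β| ≤ deriv (F q β) (aFix q β) * linf (alphaVec X) (mVec q β)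
          + K * linf (alphaVec X) (mVec q β) ^ 2 ∧
        ∑ τ, swStep n q β X τ * linf (alphaVec τ) (kappaVec q b) ≤ C / √n := by
  obtain ⟨ha, hb, hρ0, -, K, η, hK, hη, hexp⟩ := drift_expansion hq hβ
  obtain ⟨hqa, ha1, -⟩ := aFix_spec hq hβ
  set a := aFix q β with hadef
  set ρ := deriv (F q β) a with hρdef
  have hq' : (2 : ℝ) ≤ q := by exact_mod_cast hq
  have hβ0 : 0 < β := by linarith
  obtain ⟨hθ, -⟩ := theta_spec ha
  set θ₀ := theta (β * a) with hθ₀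
  have hθ0 : 0 < θ₀ := hθ.1
  set b' := (1 - a) / ((q : ℝ) - 1) with hb'
  have hb'0 : 0 ≤ b' := div_nonneg (by linarith) (by linarith)
  have hβb' : 0 ≤ β * b' := mul_nonneg hβ0.le hb'0
  set κ := Real.exp (-β) / 2 with hκdef
  have hκ : 0 < κ := by positivity
  obtain ⟨C, hC, hone⟩ := exists_swStep_linf_le q hq (β := β) (κ := κ) (s₁ := θ₀ / 2)
    (η := κ * (θ₀ / 2) / 6 / ((1 + Real.exp β) * Real.exp β)) (r₀ := (1 + β * b') / 2)
  refine ⟨K, min (min η (a - 1 / q)) (min ((1 - β * b') / 2 / β) (θ₀ / 2 / (2 * Real.exp β * β))),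
    C, hK, ?_, hC, ?_⟩
  · refine lt_min (lt_min hη (by linarith)) (lt_min (div_pos (by linarith) hβ0) (by positivity))
  intro n X hn hX
  obtain ⟨i, hi, hj⟩ := exists_dominant_spin hq X (le_refl (linf (alphaVec X) (kappaVec q a)))
  change |cntFrac X i - a| ≤ linf (alphaVec X) (mVec q β) at hi
  change ∀ j, j ≠ i → cntFrac X j ≤ b' + linf (alphaVec X) (mVec q β) at hj
  set D := linf (alphaVec X) (mVec q β) with hD
  have hD1 : D ≤ η := hX.trans ((min_le_left _ _).trans (min_le_left _ _))
  have hD2 : D ≤ a - 1 / q := hX.trans ((min_le_left _ _).trans (min_le_right _ _))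
  have hD3 : β * D ≤ (1 - β * b') / 2 := by
    have := hX.trans ((min_le_right _ _).trans (min_le_left _ _))
    rw [le_div_iff₀ hβ0] at this
    linarith
  have hD4 : 2 * Real.exp β * β * D ≤ θ₀ / 2 := by
    have := hX.trans ((min_le_right _ _).trans (min_le_right _ _))
    rw [le_div_iff₀ (by positivity)] at this
    linarith
  obtain ⟨hx1, hxF⟩ := hexp (cntFrac X i) (hi.trans hD1)
  have hxle : cntFrac X i ≤ 1 := cntFrac_le_one X i
  have hxq : 1 / (q : ℝ) ≤ cntFrac X i := by linarith [(abs_le.1 hi).1]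
  have hn' : (0 : ℝ) < n := by exact_mod_cast hn
  have hnN : n ≤ q * cntN X i := by
    have h : 1 / (q : ℝ) ≤ (cntN X i : ℝ) / n := hxq
    rw [div_le_div_iff₀ (by positivity) hn', one_mul] at h
    rw [mul_comm]
    exact_mod_cast h
  have hNpos : 0 < cntN X i := by
    by_contra h0
    rw [not_lt, Nat.le_zero] at h0
    rw [h0] at hnN
    omega
  obtain ⟨hs, hseq⟩ := theta_spec hx1
  have hlip := theta_lipschitz hx1 ha (mul_le_of_le_one_right hβ0.le hxle)
  rw [← mul_sub, abs_mul, abs_of_pos hβ0] at hlip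
  have hθx : θ₀ / 2 ≤ theta (β * cntFrac X i) := by
    have h1 : 2 * Real.exp β * (β * |cntFrac X i - a|) ≤ 2 * Real.exp β * β * D := by
      rw [mul_assoc (2 * Real.exp β)]
      gcongr
    linarith [(abs_le.1 hlip).1]
  have H : OneSupercritical X i β κ (theta (β * cntFrac X i)) (θ₀ / 2)
      (κ * (θ₀ / 2) / 6 / ((1 + Real.exp β) * Real.exp β)) ((1 + β * b') / 2) := by
    refine ⟨hβ0.le, hNpos, hκ, ?_, hs.1, hs.2, hseq, by positivity, hθx, by positivity, ?_,
      by positivity, by linarith, ?_⟩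
    · change 2 * κ ≤ (β * cntFrac X i) ^ 2 * Real.exp (-(β * cntFrac X i))
      have h1 : Real.exp (-β) ≤ Real.exp (-(β * cntFrac X i)) :=
        Real.exp_le_exp.2 (neg_le_neg (mul_le_of_le_one_right hβ0.le hxle))
      have h2 : 1 ≤ (β * cntFrac X i) ^ 2 := one_le_pow₀ hx1.le
      have h3 := Real.exp_pos (-(β * cntFrac X i))
      rw [hκdef]
      nlinarith
    · rw [div_mul_cancel₀ _ (by positivity)]
    · intro j hji
      have h1 := mul_le_mul_of_nonneg_left (hj j hji) hβ0.le
      change β * cntFrac X j ≤ _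
      linarith
  refine ⟨F q β (cntFrac X i), hxF.trans ?_, ?_⟩
  · rw [← sq_abs (cntFrac X i - a)]
    have h1 := mul_le_mul_of_nonneg_left hi hρ0.le
    have h2 := mul_le_mul_of_nonneg_left (pow_le_pow_left₀ (abs_nonneg _) hi 2) hK
    exact add_le_add h1 h2
  · have h := hone n X i _ hn hnN H
    have hF : F q β (cntFrac X i) = theta (β * cntFrac X i) * (cntN X i / n)
        + (1 - theta (β * cntFrac X i) * (cntN X i / n)) / q := by
      change 1 / (q : ℝ) + (1 - 1 / q) * theta (β * cntFrac X i) * (cntN X i / n) = _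
      ring
    rw [hF]
    exact h

/-- The map `y + A y²` contracts by `ρ` along `D ↦ ρ D + K D²` near zero, also in the presence of
an additive noise `W`. -/
lemma quadratic_contraction {ρ K A ε₀ D E W : ℝ} (hρ0 : 0 < ρ) (hρ1 : ρ < 1) (hK : 0 ≤ K)
    (hA0 : 0 ≤ A) (hAK : A * (ρ * (1 - ρ)) = 2 * K) (hε₀1 : ε₀ ≤ 1)
    (hKε : K * ε₀ ≤ ρ * (1 - ρ) / 6) (hD0 : 0 ≤ D) (hX : D ≤ ε₀) (hW0 : 0 ≤ W)
    (hE0 : 0 ≤ E) (hE1 : E ≤ 1) (htri : E ≤ W + (ρ * D + K * D ^ 2)) :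
    E + A * E ^ 2 ≤ ρ * (D + A * D ^ 2) + (1 + 2 * A) * W ∧
      (ε₀ < E → (1 - ρ) / 2 * ε₀ ≤ W) := by
  obtain ⟨y, hy⟩ : ∃ y, y = ρ * D + K * D ^ 2 := ⟨_, rfl⟩
  rw [← hy] at htri
  have hy0 : 0 ≤ y := by rw [hy]; positivity
  have hx : K * D ≤ ρ * (1 - ρ) / 6 := (mul_le_mul_of_nonneg_left hX hK).trans hKε
  have hx0 : 0 ≤ K * D := by positivity
  have hyD : y = (ρ + K * D) * D := by rw [hy]; ring
  obtain ⟨x, hxdef⟩ : ∃ x, x = K * D := ⟨_, rfl⟩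
  rw [← hxdef] at hx hx0 hyD
  have hr1 : ρ * (1 - ρ) ≤ 1 - ρ := mul_le_of_le_one_left (by linarith) hρ1.le
  have hfac : ρ + x ≤ (1 + ρ) / 2 := by linarith
  have hyε : y ≤ (1 + ρ) / 2 * ε₀ := by
    rw [hyD]
    exact mul_le_mul hfac hX hD0 (by linarith)
  have hy1 : y ≤ 1 := by nlinarith
  refine ⟨?_, fun h => by linarith⟩
  have h1 : E ^ 2 ≤ y ^ 2 + 2 * W := by
    rcases le_total E y with h | h
    · have := pow_le_pow_left₀ hE0 h 2
      linarith
    · nlinarith [mul_nonneg (sub_nonneg.2 h) (by linarith : 0 ≤ 2 - (E + y))]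
  have hsq : (ρ + x) ^ 2 ≤ ρ ^ 2 + ρ * (1 - ρ) / 2 := by
    have h3 : ρ * x ≤ x := mul_le_of_le_one_left hx0 hρ1.le
    have h4 : x * x ≤ x := mul_le_of_le_one_left hx0 (by linarith)
    linarith
  have h2 : A * y ^ 2 + K * D ^ 2 ≤ ρ * (A * D ^ 2) := by
    have h3 : A * (ρ + x) ^ 2 + K ≤ ρ * A := by
      have := mul_le_mul_of_nonneg_left hsq hA0
      linarith
    have h4 := mul_le_mul_of_nonneg_right h3 (sq_nonneg D)
    rw [hyD]
    linarith
  have h5 := mul_le_mul_of_nonneg_left h1 hA0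
  linarith

/-- One step of the dynamics contracts `D + A D²`, where `D` is the distance to the majority
vector, up to a noise `W` of order `1/√n`. -/
theorem exists_swStep_contraction (q : ℕ) (hq : 2 ≤ q) {β : ℝ} (hβ : (q : ℝ) < β) :
    ∃ ε₀ A B L C : ℝ, 0 < ε₀ ∧ 0 ≤ A ∧ 0 ≤ B ∧ 0 ≤ L ∧ 0 ≤ C ∧ ∀ (n : ℕ) (X : Conf n q), 0 < n →
      linf (alphaVec X) (mVec q β) ≤ ε₀ →
      ∃ W : Conf n q → ℝ, (∀ τ, 0 ≤ W τ) ∧ ∑ τ, swStep n q β X τ * W τ ≤ C / √n ∧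
        ∀ τ, linf (alphaVec τ) (mVec q β) + A * linf (alphaVec τ) (mVec q β) ^ 2 ≤
            deriv (F q β) (aFix q β) *
              (linf (alphaVec X) (mVec q β) + A * linf (alphaVec X) (mVec q β) ^ 2) + B * W τ ∧
          (ε₀ < linf (alphaVec τ) (mVec q β) → 1 ≤ L * W τ) := by
  obtain ⟨K, ε₁, C, hK, hε₁, hC, hstep⟩ := exists_swStep_drift q hq hβ
  obtain ⟨-, -, hρ0, hρ1, -⟩ := drift_expansion hq hβ
  obtain ⟨ha, ha1, -⟩ := aFix_spec hq hβ
  have hq0 : 0 < q := by omega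
  have ha0 : 0 ≤ aFix q β := le_trans (by positivity) ha.le
  set ρ := deriv (F q β) (aFix q β) with hρ
  have hr : 0 < ρ * (1 - ρ) := mul_pos hρ0 (by linarith)
  set ε₀ := min ε₁ (min 1 (ρ * (1 - ρ) / (6 * (K + 1)))) with hε₀def
  have hε₀ : 0 < ε₀ := lt_min hε₁ (lt_min one_pos (by positivity))
  have hε₀1 : ε₀ ≤ 1 := (min_le_right _ _).trans (min_le_left _ _)
  have hKε : K * ε₀ ≤ ρ * (1 - ρ) / 6 := by
    have h : ε₀ ≤ ρ * (1 - ρ) / (6 * (K + 1)) := (min_le_right _ _).trans (min_le_right _ _)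
    rw [le_div_iff₀ (by positivity)] at h
    nlinarith
  have hgap : 0 < (1 - ρ) / 2 * ε₀ := mul_pos (by linarith) hε₀
  refine ⟨ε₀, 2 * K / (ρ * (1 - ρ)), 1 + 2 * (2 * K / (ρ * (1 - ρ))), 1 / ((1 - ρ) / 2 * ε₀), C,
    hε₀, by positivity, by positivity, by positivity, hC, ?_⟩
  intro n X hn hX
  obtain ⟨b, hb, hW⟩ := hstep n X hn (hX.trans (min_le_left _ _))
  have hA0 : 0 ≤ 2 * K / (ρ * (1 - ρ)) := by positivity
  have hAK : 2 * K / (ρ * (1 - ρ)) * (ρ * (1 - ρ)) = 2 * K := div_mul_cancel₀ _ hr.ne'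
  refine ⟨fun τ => linf (alphaVec τ) (kappaVec q b), fun τ => linf_nonneg _ _, hW, fun τ => ?_⟩
  have htri : linf (alphaVec τ) (mVec q β) ≤ linf (alphaVec τ) (kappaVec q b) +
      (ρ * linf (alphaVec X) (mVec q β) + K * linf (alphaVec X) (mVec q β) ^ 2) :=
    (linf_triangle hq0 _ (kappaVec q b) _).trans
      (add_le_add le_rfl ((linf_kappaVec_le hq _ _).trans hb))
  obtain ⟨h1, h2⟩ := quadratic_contraction hρ0 hρ1 hK hA0 hAK hε₀1 hKε (linf_nonneg _ _) hX
    (linf_nonneg _ _) (linf_nonneg _ _) (linf_alphaVec_le_one hq τ ha0 ha1) htri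
  refine ⟨h1, fun h => ?_⟩
  rw [one_div, inv_mul_eq_div, le_div_iff₀ hgap, one_mul]
  exact h2 h

/-- Tail bound for the distance to the majority vector after `t` steps, given a one-step
contraction up to a noise of mean at most `c`. -/
theorem sum_swProb_linf_gt_le {n q : ℕ} (hq : 0 < q) {β : ℝ} (hβ : 0 ≤ β)
    {ρ ε₀ A B L c s : ℝ} (hρ0 : 0 ≤ ρ) (hA : 0 ≤ A) (hB : 0 ≤ B) (hL : 0 ≤ L)
    (hc : 0 ≤ c) (hs : 0 < s)
    (hstep : ∀ X : Conf n q, linf (alphaVec X) (mVec q β) ≤ ε₀ →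
      ∃ W : Conf n q → ℝ, (∀ τ, 0 ≤ W τ) ∧ ∑ τ, swStep n q β X τ * W τ ≤ c ∧
        ∀ τ, linf (alphaVec τ) (mVec q β) + A * linf (alphaVec τ) (mVec q β) ^ 2 ≤
            ρ * (linf (alphaVec X) (mVec q β) + A * linf (alphaVec X) (mVec q β) ^ 2) + B * W τ ∧
          (ε₀ < linf (alphaVec τ) (mVec q β) → 1 ≤ L * W τ))
    (t : ℕ) (X : Conf n q) (hX : linf (alphaVec X) (mVec q β) ≤ ε₀) :
    ∑ τ, (if s < linf (alphaVec τ) (mVec q β) then swProb n q β t X τ else 0) ≤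
      (ρ ^ t * (linf (alphaVec X) (mVec q β) + A * linf (alphaVec X) (mVec q β) ^ 2) +
        B * c * ∑ k ∈ range t, ρ ^ k) / s + t * (L * c) := by
  induction t generalizing X with
  | zero =>
    have hsum : ∑ τ, (if s < linf (alphaVec τ) (mVec q β) then swProb n q β 0 X τ else 0)
        = if s < linf (alphaVec X) (mVec q β) then 1 else 0 := by
      rw [Finset.sum_eq_single X]
      · simp [swProb]
      · intro τ _ hτ
        simp [swProb, hτ.symm]
      · simp
    rw [hsum]
    have hD := linf_nonneg (alphaVec X) (mVec q β)
    have hAD : 0 ≤ A * linf (alphaVec X) (mVec q β) ^ 2 := by positivity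
    simp only [pow_zero, one_mul, Nat.cast_zero, zero_mul, add_zero, range_zero, sum_empty,
      mul_zero]
    split_ifs with h
    · rw [le_div_iff₀ hs]
      linarith
    · positivity
  | succ t ih =>
    obtain ⟨W, hW0, hWc, hW⟩ := hstep X hX
    obtain ⟨S, hS⟩ : ∃ S, S = ∑ k ∈ range t, ρ ^ k := ⟨_, rfl⟩
    have hS0 : 0 ≤ S := by rw [hS]; exact sum_nonneg fun k _ => pow_nonneg hρ0 k
    simp only [← hS] at ih
    rw [sum_range_succ, ← hS]
    set H : Conf n q → ℝ :=
      fun τ => linf (alphaVec τ) (mVec q β) + A * linf (alphaVec τ) (mVec q β) ^ 2 with hH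
    have hH0 : ∀ τ, 0 ≤ H τ := fun τ => by
      have := linf_nonneg (alphaVec τ) (mVec q β)
      simp only [hH]
      positivity
    have hpoint : ∀ η, ∑ τ, (if s < linf (alphaVec τ) (mVec q β) then swProb n q β t η τ else 0) ≤
        ((ρ ^ t * (ρ * H X) + B * c * S) / s + t * (L * c)) +
          (ρ ^ t * B / s + L) * W η := by
      intro η
      have hη := (hW η).1
      by_cases h : linf (alphaVec η) (mVec q β) ≤ ε₀
      · refine (ih η h).trans ?_
        have h1 : ρ ^ t * H η ≤ ρ ^ t * (ρ * H X + B * W η) :=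
          mul_le_mul_of_nonneg_left hη (pow_nonneg hρ0 t)
        have h2 : (ρ ^ t * H η + B * c * S) / s ≤
            (ρ ^ t * (ρ * H X + B * W η) + B * c * S) / s := by gcongr
        have h3 : 0 ≤ L * W η := mul_nonneg hL (hW0 η)
        have h4 : (ρ ^ t * (ρ * H X + B * W η) + B * c * S) / s =
            (ρ ^ t * (ρ * H X) + B * c * S) / s + ρ ^ t * B / s * W η := by ring
        change (ρ ^ t * H η + B * c * S) / s + t * (L * c) ≤ _
        linarith
      · have h1 : ∑ τ, (if s < linf (alphaVec τ) (mVec q β) then swProb n q β t η τ else 0) ≤ 1 := by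
          rw [← sum_swProb (n := n) hq β t η]
          refine Finset.sum_le_sum fun τ _ => ?_
          split_ifs
          · exact le_rfl
          · exact swProb_nonneg hβ t η τ
        have h2 := (hW η).2 (not_le.1 h)
        have h3 : 0 ≤ (ρ ^ t * (ρ * H X) + B * c * S) / s + t * (L * c) := by
          have := hH0 X
          positivity
        have h4 : 0 ≤ ρ ^ t * B / s * W η := by
          have := hW0 η
          positivity
        linarith
    have hexch : ∑ τ, (if s < linf (alphaVec τ) (mVec q β) then swProb n q β (t + 1) X τ else 0) =
        ∑ η, swStep n q β X η *
          ∑ τ, (if s < linf (alphaVec τ) (mVec q β) then swProb n q β t η τ else 0) := by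
      simp_rw [Finset.mul_sum]
      rw [Finset.sum_comm]
      refine Finset.sum_congr rfl fun τ _ => ?_
      split_ifs
      · rfl
      · simp
    rw [hexch]
    calc _ ≤ ∑ η, swStep n q β X η *
          (((ρ ^ t * (ρ * H X) + B * c * S) / s + t * (L * c)) +
            (ρ ^ t * B / s + L) * W η) :=
          Finset.sum_le_sum fun η _ =>
            mul_le_mul_of_nonneg_left (hpoint η) (swStep_nonneg hβ X η)
      _ = ((ρ ^ t * (ρ * H X) + B * c * S) / s + t * (L * c)) +
            (ρ ^ t * B / s + L) * ∑ η, swStep n q β X η * W η := by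
          generalize (ρ ^ t * (ρ * H X) + B * c * S) / s + t * (L * c) = u
          simp_rw [mul_add (swStep n q β X _) u]
          rw [Finset.sum_add_distrib, ← Finset.sum_mul, sum_swStep hq, one_mul, Finset.mul_sum]
          congr 1
          exact Finset.sum_congr rfl fun η _ => mul_left_comm _ _ _
      _ ≤ ((ρ ^ t * (ρ * H X) + B * c * S) / s + t * (L * c)) + (ρ ^ t * B / s + L) * c := by
          gcongr
      _ = _ := by
          simp only [hH]
          push_cast
          ring

/-- `ρ ^ T ≤ 1 / √n` once `T ≥ log n / (2 log (1/ρ))`. -/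
lemma pow_le_inv_sqrt {ρ γ : ℝ} (hρ0 : 0 < ρ) (hρ1 : ρ < 1) (hγ : 0 ≤ γ) {n : ℕ} (hn : 0 < n) :
    ρ ^ ⌈(2 * Real.log (1 / ρ))⁻¹ * Real.log n + γ⌉₊ ≤ 1 / √n := by
  have hn' : (0 : ℝ) < n := by exact_mod_cast hn
  have hlog : Real.log ρ < 0 := Real.log_neg hρ0 hρ1
  have hT := Nat.le_ceil ((2 * Real.log (1 / ρ))⁻¹ * Real.log n + γ)
  rw [← Real.log_le_log_iff (by positivity) (by positivity), Real.log_pow, one_div (√(n : ℝ)),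
    Real.log_inv, Real.log_sqrt hn'.le]
  have h1 : (2 * Real.log (1 / ρ))⁻¹ * Real.log n * Real.log ρ = -(Real.log n / 2) := by
    have hne := hlog.ne
    rw [one_div, Real.log_inv]
    generalize Real.log ρ = l at hne
    field_simp
  have h2 := mul_le_mul_of_nonpos_right (by linarith :
    (2 * Real.log (1 / ρ))⁻¹ * Real.log n ≤ ⌈(2 * Real.log (1 / ρ))⁻¹ * Real.log n + γ⌉₊) hlog.le
  linarith

/-- A logarithmic number of steps is `o(√n)`. -/
lemma tendsto_ceil_log_div_sqrt {κ γ : ℝ} (hκ : 0 ≤ κ) (hγ : 0 ≤ γ) (M : ℝ) :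
    Filter.Tendsto (fun n : ℕ => (⌈κ * Real.log n + γ⌉₊ : ℝ) * (M / √n)) Filter.atTop
      (nhds 0) := by
  have hlog : Filter.Tendsto (fun n : ℕ => Real.log n / √n) Filter.atTop (nhds 0) := by
    have h := (isLittleO_log_rpow_atTop (by norm_num : (0 : ℝ) < 1 / 2)).tendsto_div_nhds_zero
    refine (h.comp tendsto_natCast_atTop_atTop).congr fun n => ?_
    rw [Real.sqrt_eq_rpow]
    rfl
  have hinv : Filter.Tendsto (fun n : ℕ => 1 / √n) Filter.atTop (nhds 0) :=
    (tendsto_const_nhds.div_atTop (Real.tendsto_sqrt_atTop.comp tendsto_natCast_atTop_atTop))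
  have hup : Filter.Tendsto (fun n : ℕ => κ * (Real.log n / √n) + (γ + 1) * (1 / √n))
      Filter.atTop (nhds 0) := by
    simpa using (hlog.const_mul κ).add (hinv.const_mul (γ + 1))
  have hmain : Filter.Tendsto (fun n : ℕ => (⌈κ * Real.log n + γ⌉₊ : ℝ) / √n) Filter.atTop
      (nhds 0) := by
    refine squeeze_zero (fun n => by positivity) (fun n => ?_) hup
    have h1 : (⌈κ * Real.log n + γ⌉₊ : ℝ) ≤ κ * Real.log n + γ + 1 :=
      (Nat.ceil_lt_add_one (add_nonneg (mul_nonneg hκ (Real.log_natCast_nonneg n)) hγ)).le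
    calc (⌈κ * Real.log n + γ⌉₊ : ℝ) / √n ≤ (κ * Real.log n + γ + 1) / √n := by gcongr
      _ = _ := by ring
  have h := hmain.mul_const M
  rw [zero_mul] at h
  refine h.congr fun n => by ring

/-- Lemma 3.2: starting within a small constant `ℓ∞`-distance of `m`,
after `T = ⌈c(β,q) log n + γ⌉` steps the SW dynamics is within `C/√n` of `m`
with probability at least `δ`. -/
theorem sw_contract_to_m (q : ℕ) (hq : 2 ≤ q) (β : ℝ) (hβ : (q : ℝ) < β) :
    ∃ ε₀ : ℝ, 0 < ε₀ ∧ ∀ ε : ℝ, ε ∈ Set.Ioc (0 : ℝ) ε₀ → ∀ γ : ℝ, 0 < γ →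
      ∀ δ : ℝ, δ ∈ Set.Ioo (0 : ℝ) 1 → ∃ C : ℝ, 0 < C ∧ ∃ N : ℕ, ∀ n : ℕ, N ≤ n →
        ∀ X₀ : Conf n q, linf (alphaVec X₀) (mVec q β) ≤ ε →
          δ ≤ ∑ τ : Conf n q,
            (if linf (alphaVec τ) (mVec q β) ≤ C / Real.sqrt n
              then swProb n q β (Nat.ceil (cConst q β * Real.log n + γ)) X₀ τ else 0) := by
  obtain ⟨ε₀, A, B, L, C, hε₀, hA, hB, hL, hC, hstep⟩ := exists_swStep_contraction q hq hβ
  obtain ⟨-, -, hρ0, hρ1, -⟩ := drift_expansion hq hβ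
  have hq0 : 0 < q := by omega
  have hβ0 : 0 ≤ β := (Nat.cast_nonneg q).trans hβ.le
  refine ⟨ε₀, hε₀, fun ε hε γ hγ δ hδ => ?_⟩
  have hκ : 0 ≤ cConst q β :=
    inv_nonneg.2 (mul_nonneg zero_le_two (Real.log_nonneg (one_le_one_div hρ0 hρ1.le)))
  have hδ1 : 0 < (1 - δ) / 2 := by linarith [hδ.2]
  obtain ⟨R, hR⟩ : ∃ R, R = ε₀ + A * ε₀ ^ 2 + B * C * (1 / (1 - deriv (F q β) (aFix q β))) :=
    ⟨_, rfl⟩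
  have hR0 : 0 < R := by
    have : 0 < 1 - deriv (F q β) (aFix q β) := by linarith
    rw [hR]
    positivity
  obtain ⟨N, hN⟩ := Filter.eventually_atTop.1
    ((tendsto_ceil_log_div_sqrt hκ hγ.le (L * C)).eventually (ge_mem_nhds hδ1))
  refine ⟨R / ((1 - δ) / 2), by positivity, N + 1, fun n hn X₀ hX₀ => ?_⟩
  have hn0 : 0 < n := by omega
  have hn' : (0 : ℝ) < n := by exact_mod_cast hn0
  have hsqrt : 0 < √(n : ℝ) := Real.sqrt_pos.2 hn'
  have hX : linf (alphaVec X₀) (mVec q β) ≤ ε₀ := hX₀.trans hε.2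
  have hNn := hN n (by omega)
  have hpow : deriv (F q β) (aFix q β) ^ ⌈cConst q β * Real.log n + γ⌉₊ ≤ 1 / √n :=
    pow_le_inv_sqrt hρ0 hρ1 hγ.le hn0
  obtain ⟨T, hT⟩ : ∃ T, T = ⌈cConst q β * Real.log n + γ⌉₊ := ⟨_, rfl⟩
  rw [← hT] at hNn hpow ⊢
  have htail := sum_swProb_linf_gt_le hq0 hβ0 hρ0.le hA hB hL
    (div_nonneg hC hsqrt.le) (s := R / ((1 - δ) / 2) / √n) (by positivity)
    (fun X hX => hstep n X hn0 hX) T X₀ hX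
  have hgeom : ∑ k ∈ range T, deriv (F q β) (aFix q β) ^ k ≤
      1 / (1 - deriv (F q β) (aFix q β)) := by
    rw [le_div_iff₀ (by linarith), geom_sum_mul_neg]
    linarith [pow_pos hρ0 T]
  have hD0 := linf_nonneg (alphaVec X₀) (mVec q β)
  have hnum : deriv (F q β) (aFix q β) ^ T *
      (linf (alphaVec X₀) (mVec q β) + A * linf (alphaVec X₀) (mVec q β) ^ 2) +
        B * (C / √n) * ∑ k ∈ range T, deriv (F q β) (aFix q β) ^ k ≤ R / √n := by
    calc _ ≤ 1 / √n * (ε₀ + A * ε₀ ^ 2) +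
          B * (C / √n) * (1 / (1 - deriv (F q β) (aFix q β))) := by gcongr
      _ = R / √n := by rw [hR]; ring
  have hfirst := div_le_div_of_nonneg_right hnum
    (by positivity : 0 ≤ R / ((1 - δ) / 2) / √(n : ℝ))
  have hratio : R / √n / (R / ((1 - δ) / 2) / √n) = (1 - δ) / 2 := by
    field_simp
  have hsplit : ∑ τ : Conf n q, (if linf (alphaVec τ) (mVec q β) ≤ R / ((1 - δ) / 2) / √n
        then swProb n q β T X₀ τ else 0) +
      ∑ τ, (if R / ((1 - δ) / 2) / √n < linf (alphaVec τ) (mVec q β)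
        then swProb n q β T X₀ τ else 0) = 1 := by
    rw [← Finset.sum_add_distrib]
    refine Eq.trans ?_ (sum_swProb hq0 β T X₀)
    refine Finset.sum_congr rfl fun τ _ => ?_
    by_cases h : linf (alphaVec τ) (mVec q β) ≤ R / ((1 - δ) / 2) / √n
    · rw [if_pos h, if_neg (not_lt.2 h), add_zero]
    · rw [if_neg h, if_pos (not_le.1 h), zero_add]
  have htime : (T : ℝ) * (L * (C / √n)) ≤ (1 - δ) / 2 := by
    rw [← mul_div_assoc]
    exact hNn
  linarith
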